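/- Let R̂ and F̂ be compatible R-matrices with F̂ closed, A a unital associative k-algebra, and M a matrix of generators of M(R̂,F̂). For polynomials Y^{(k)} in R̂₁,…,R̂_{k−1} and Z^{(i)} in R̂₁,…,R̂_{i−1}, set α(Y^{(k)}) := Tr_F(1,…,k)(Y^{(k)} M_{1̄}⋯M_{k̄}) and β(Z^{(i)}) := Tr_F(1,…,i)(Z^{(i)} M_{1̄}⋯M_{ī}). Then α(Y^{(k)}) and β(Z^{(i)}) commute in A: α(Y^{(k)})·β(Z^{(i)}) = β(Z^{(i)})·α(Y^{(k)}). In particular, the characteristic subalgebra of M(R̂,F̂), i.e. the subalgebra of A generated by all such elements, is abelian. -/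

import Mathlib

/-! Common definitions for quantum matrix algebras `M(R̂,F̂)` in the sense of
Isaev–Ogievetsky–Pyatov, "On quantum matrix algebras satisfying the
Cayley-Hamilton-Newton identities".

We model operators on `V^{⊗m}` (where `dim V = N`) as matrices indexed by
multi-indices `Fin m → Fin N`; entries are taken in a (possibly
noncommutative) unital associative algebra `A` over a field `K`.
Sites (tensor factors) are numbered starting from `0`, so the paper's
`X_i` is `site m (i-1) X`, and the paper's `M_{\overline{k}}` is
`Mbar m F F⁻¹ M (k-1)`. -/

namespace CHN

noncomputable section

/-- Operators on `V^{⊗m}` (`dim V = N`) with entries in a ring `A`. -/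
abbrev Op (N : ℕ) (A : Type*) [Ring A] (m : ℕ) :=
  Matrix (Fin m → Fin N) (Fin m → Fin N) A

/-- Operators on `V ⊗ V`. -/
abbrev M2 (N : ℕ) (A : Type*) [Ring A] :=
  Matrix (Fin N × Fin N) (Fin N × Fin N) A

/-- `site m i X` places the two-site operator `X` at the (0-based) tensor
factors `i, i+1` of `V^{⊗m}`, acting as the identity elsewhere.  In the
paper's 1-based notation, `X_i = site m (i-1) X`.  (Out of range it is the
identity.) -/
def site {A : Type*} [Ring A] {N : ℕ} (m i : ℕ) (X : M2 N A) : Op N A m :=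
  fun a b =>
    if h : i + 1 < m then
      X (a ⟨i, Nat.lt_of_succ_lt h⟩, a ⟨i + 1, h⟩)
          (b ⟨i, Nat.lt_of_succ_lt h⟩, b ⟨i + 1, h⟩) *
        (if ∀ j : Fin m, (j : ℕ) ≠ i → (j : ℕ) ≠ i + 1 → a j = b j then 1 else 0)
    else if a = b then 1 else 0

/-- `site1 m i X` places the one-site operator `X` at the (0-based) factor `i`. -/
def site1 {A : Type*} [Ring A] {N : ℕ} (m i : ℕ) (X : Matrix (Fin N) (Fin N) A) :
    Op N A m :=
  fun a b =>
    if h : i < m then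
      X (a ⟨i, h⟩) (b ⟨i, h⟩) *
        (if ∀ j : Fin m, (j : ℕ) ≠ i → a j = b j then 1 else 0)
    else if a = b then 1 else 0

/-- `chain m X i l = X_i X_{i+1} ⋯ X_{i+l-1}` (0-based sites, `l` factors); in
the paper's 1-based notation this is `X_{i+1 → i+l}`. -/
def chain {A : Type*} [Ring A] {N : ℕ} (m : ℕ) (X : M2 N A) (i : ℕ) :
    ℕ → Op N A m
  | 0 => 1
  | l + 1 => chain m X i l * site m (i + l) X

/-- The Yang–Baxter equation `X₁X₂X₁ = X₂X₁X₂` on `V^{⊗3}`. -/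
def YB {A : Type*} [Ring A] {N : ℕ} (X : M2 N A) : Prop :=
  site 3 0 X * site 3 1 X * site 3 0 X = site 3 1 X * site 3 0 X * site 3 1 X

/-- Compatibility of a pair of R-matrices: both Yang–Baxter equations together
with the conditions `R̂₁F̂₂F̂₁ = F̂₂F̂₁R̂₂` and `F̂₁F̂₂R̂₁ = R̂₂F̂₁F̂₂` on `V^{⊗3}`. -/
def Compatible {A : Type*} [Ring A] {N : ℕ} (R F : M2 N A) : Prop :=
  YB R ∧ YB F ∧
    site 3 0 R * site 3 1 F * site 3 0 F = site 3 1 F * site 3 0 F * site 3 1 R ∧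
    site 3 0 F * site 3 1 F * site 3 0 R = site 3 1 R * site 3 0 F * site 3 1 F

/-- `Ψ` witnesses closedness of `F̂`:  `Ψ^{af}_{cg} F̂^{gb}_{fd} = δ^a_d δ^b_c`. -/
def IsClosedPair {A : Type*} [Ring A] {N : ℕ} (F Ψ : M2 N A) : Prop :=
  ∀ a b c d : Fin N,
    (∑ f : Fin N, ∑ g : Fin N, Ψ (a, f) (c, g) * F (g, b) (f, d)) =
      if a = d ∧ b = c then 1 else 0

/-- The matrix `D`, `D^a_b := Ψ^{ac}_{bc}`. -/
def Dmat {A : Type*} [Ring A] {N : ℕ} (Ψ : M2 N A) : Matrix (Fin N) (Fin N) A :=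
  fun a b => ∑ c : Fin N, Ψ (a, c) (b, c)

/-- Quantum trace (with weight `D`) over the last tensor factor. -/
def qtr1 {K : Type*} [Field K] {A : Type*} [Ring A] [Algebra K A] {N m : ℕ}
    (D : Matrix (Fin N) (Fin N) K) (X : Op N A (m + 1)) : Op N A m :=
  fun a b => ∑ c : Fin N, ∑ e : Fin N,
    algebraMap K A (D c e) * X (Fin.snoc a e) (Fin.snoc b c)

/-- Quantum trace over the last `j` tensor factors. -/
def qtrs {K : Type*} [Field K] {A : Type*} [Ring A] [Algebra K A] {N : ℕ}
    (D : Matrix (Fin N) (Fin N) K) (m : ℕ) :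
    (j : ℕ) → Op N A (m + j) → Op N A m
  | 0, X => X
  | j + 1, X => qtrs D m j (qtr1 D X)

/-- Full quantum trace `Tr_F(1,…,m)`, with values in `A`. -/
def qtrAll {K : Type*} [Field K] {A : Type*} [Ring A] [Algebra K A] {N m : ℕ}
    (D : Matrix (Fin N) (Fin N) K) (X : Op N A m) : A :=
  ∑ a : Fin m → Fin N, ∑ b : Fin m → Fin N,
    algebraMap K A (∏ i, D (a i) (b i)) * X b a

/-- Quantum trace of a one-site operator:  `Tr_F X = Tr (D X)`. -/
def trF {K : Type*} [Field K] {A : Type*} [Ring A] [Algebra K A] {N : ℕ}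
    (D : Matrix (Fin N) (Fin N) K) (X : Matrix (Fin N) (Fin N) A) : A :=
  ∑ a : Fin N, ∑ b : Fin N, algebraMap K A (D a b) * X b a

/-- Ordinary partial trace over the last tensor factor. -/
def ptr1 {A : Type*} [Ring A] {N m : ℕ} (X : Op N A (m + 1)) : Op N A m :=
  fun a b => ∑ c : Fin N, X (Fin.snoc a c) (Fin.snoc b c)

/-- Ordinary partial trace over the last `j` tensor factors. -/
def ptrs {A : Type*} [Ring A] {N : ℕ} (m : ℕ) :
    (j : ℕ) → Op N A (m + j) → Op N A m
  | 0, X => X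
  | j + 1, X => ptrs m j (ptr1 X)

/-- `Mbar m F Finv M k` is the paper's `M_{\overline{k+1}}` (0-based index `k`):
`M_{\overline{1}} := M₁` and `M_{\overline{k+1}} := F̂_k M_{\overline{k}} F̂_k⁻¹`. -/
def Mbar {A : Type*} [Ring A] {N : ℕ} (m : ℕ) (F Finv : M2 N A)
    (M : Matrix (Fin N) (Fin N) A) : ℕ → Op N A m
  | 0 => site1 m 0 M
  | k + 1 => site m k F * Mbar m F Finv M k * site m k Finv

/-- `MbarSeg m F Finv M i l = M_{\overline{i+1}} M_{\overline{i+2}} ⋯ M_{\overline{i+l}}`,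
the ordered product of `l` consecutive copies starting at 0-based index `i`.
In particular `MbarSeg m F Finv M 0 k = M_{\overline{1}} ⋯ M_{\overline{k}}`. -/
def MbarSeg {A : Type*} [Ring A] {N : ℕ} (m : ℕ) (F Finv : M2 N A)
    (M : Matrix (Fin N) (Fin N) A) (i : ℕ) : ℕ → Op N A m
  | 0 => 1
  | l + 1 => MbarSeg m F Finv M i l * Mbar m F Finv M (i + l)

/-- The double twist `R̂^{FF} = F̂ (F̂ R̂ F̂⁻¹) F̂⁻¹`. -/
def RFF {K : Type*} [Field K] {N : ℕ} (R F : M2 N K) : M2 N K :=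
  F * (F * R * F⁻¹) * F⁻¹

/-- `M` is a matrix of generators of the algebra `M(R̂,F̂)`:
`R̂₁ M_{\overline{1}} M_{\overline{2}} = M_{\overline{1}} M_{\overline{2}} (R̂^{FF})₁`
on `V ⊗ V`. -/
def IsGenerators {K : Type*} [Field K] {A : Type*} [Ring A] [Algebra K A] {N : ℕ}
    (R F : M2 N K) (M : Matrix (Fin N) (Fin N) A) : Prop :=
  site 2 0 (R.map (algebraMap K A)) *
      MbarSeg 2 (F.map (algebraMap K A)) ((F⁻¹).map (algebraMap K A)) M 0 2 =
    MbarSeg 2 (F.map (algebraMap K A)) ((F⁻¹).map (algebraMap K A)) M 0 2 *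
      site 2 0 ((RFF R F).map (algebraMap K A))

/-- Evaluation of a noncommutative polynomial `Y` in `v` variables, substituting
for the variable `x_j` the operator `R̂` placed at the (0-based) sites
`p+j, p+j+1` of `V^{⊗m}`.  For `p = 0` this is the paper's
`Y^{(v+1)} = Y^{(v+1)}(R̂₁,…,R̂_v)`, and a general `p` gives `Y^{(p+1,v+1)}`. -/
def evalY {K : Type*} [Field K] {A : Type*} [Ring A] [Algebra K A] {N m v : ℕ}
    (R : M2 N A) (p : ℕ) (Y : FreeAlgebra K (Fin v)) : Op N A m :=
  FreeAlgebra.lift K (fun j : Fin v => site m (p + (j : ℕ)) R) Y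

/-- `Ustack m R k l = R̂_{l → l+k-1} ⋯ R̂_{2 → k+1} R̂_{1 → k}` (1-based labels):
the product of `l` descending chains of length `k`. -/
def Ustack {A : Type*} [Ring A] {N : ℕ} (m : ℕ) (R : M2 N A) (k : ℕ) :
    ℕ → Op N A m
  | 0 => 1
  | l + 1 => chain m R l k * Ustack m R k l

/-- The `q`-number `n_q = (qⁿ − q⁻ⁿ)/(q − q⁻¹)`. -/
def qInt {K : Type*} [Field K] (q : K) (n : ℕ) : K :=
  (q ^ n - q⁻¹ ^ n) / (q - q⁻¹)

/-- `R̂` is a Hecke R-matrix for the parameter `q`:  it is invertible, satisfies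
the Yang–Baxter equation and the Hecke condition `R̂² = 1 + (q − q⁻¹)R̂`. -/
def IsHecke {K : Type*} [Field K] {N : ℕ} (q : K) (R : M2 N K) : Prop :=
  IsUnit R ∧ YB R ∧ R * R = 1 + (q - q⁻¹) • R

/-- The `q`-antisymmetrizer `A^{(k)}` built from `R̂`, placed at the (0-based)
tensor factors `p, p+1, …, p+k-1` of `V^{⊗m}`. -/
def qasym {K : Type*} [Field K] {N : ℕ} (q : K) (R : M2 N K) (m p : ℕ) :
    ℕ → Op N K m
  | 0 => 1
  | 1 => 1
  | k + 2 =>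
      (qInt q (k + 2))⁻¹ •
        (qasym q R m p (k + 1) *
          (q ^ (k + 1) • (1 : Op N K m) - qInt q (k + 1) • site m (p + k) R) *
          qasym q R m p (k + 1))

/-- The `q`-symmetrizer `S^{(k)}` built from `R̂`, placed at the (0-based)
tensor factors `p, p+1, …, p+k-1` of `V^{⊗m}`. -/
def qsym {K : Type*} [Field K] {N : ℕ} (q : K) (R : M2 N K) (m p : ℕ) :
    ℕ → Op N K m
  | 0 => 1
  | 1 => 1
  | k + 2 =>
      (qInt q (k + 2))⁻¹ •
        (qsym q R m p (k + 1) *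
          (q⁻¹ ^ (k + 1) • (1 : Op N K m) + qInt q (k + 1) • site m (p + k) R) *
          qsym q R m p (k + 1))

/-- The elementary symmetric function
`σ_k(M) = Tr_F(1,…,k)(A^{(k)} M_{\overline{1}}⋯M_{\overline{k}})` (with `σ_0 = 1`). -/
def sigmaF {K : Type*} [Field K] {A : Type*} [Ring A] [Algebra K A] {N : ℕ}
    (q : K) (R F Ψ : M2 N K) (M : Matrix (Fin N) (Fin N) A) (k : ℕ) : A :=
  qtrAll (Dmat Ψ)
    ((qasym q R k 0 k).map (algebraMap K A) *
      MbarSeg k (F.map (algebraMap K A)) ((F⁻¹).map (algebraMap K A)) M 0 k)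

/-- The complete symmetric function
`τ_k(M) = Tr_F(1,…,k)(S^{(k)} M_{\overline{1}}⋯M_{\overline{k}})` (with `τ_0 = 1`). -/
def tauF {K : Type*} [Field K] {A : Type*} [Ring A] [Algebra K A] {N : ℕ}
    (q : K) (R F Ψ : M2 N K) (M : Matrix (Fin N) (Fin N) A) (k : ℕ) : A :=
  qtrAll (Dmat Ψ)
    ((qsym q R k 0 k).map (algebraMap K A) *
      MbarSeg k (F.map (algebraMap K A)) ((F⁻¹).map (algebraMap K A)) M 0 k)

/-- The power sums `s_k(M) = Tr_F(1,…,k)(R̂_{1→k−1} M_{\overline{1}}⋯M_{\overline{k}})`,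
with `s_0 = 1`. -/
def sF {K : Type*} [Field K] {A : Type*} [Ring A] [Algebra K A] {N : ℕ}
    (R F Ψ : M2 N K) (M : Matrix (Fin N) (Fin N) A) : ℕ → A
  | 0 => 1
  | j + 1 =>
      qtrAll (Dmat Ψ)
        (chain (j + 1) (R.map (algebraMap K A)) 0 j *
          MbarSeg (j + 1) (F.map (algebraMap K A)) ((F⁻¹).map (algebraMap K A)) M 0 (j + 1))

/-- The `(j+1)`-st quantum power of `M`,
`M^{\overline{j+1}} = Tr_F(2,…,j+1)(R̂_{1→j} M_{\overline{1}}⋯M_{\overline{j+1}})`,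
as a one-site operator (so `MpowF R F Ψ M 0 = M₁ = M`). -/
def MpowF {K : Type*} [Field K] {A : Type*} [Ring A] [Algebra K A] {N : ℕ}
    (R F Ψ : M2 N K) (M : Matrix (Fin N) (Fin N) A) (j : ℕ) : Op N A 1 :=
  qtrs (Dmat Ψ) 1 j
    (chain (1 + j) (R.map (algebraMap K A)) 0 j *
      MbarSeg (1 + j) (F.map (algebraMap K A)) ((F⁻¹).map (algebraMap K A)) M 0 (j + 1))

/-- The `(j+1)`-st wedge power of `M`,
`M^{∧(j+1)} = Tr_F(2,…,j+1)(A^{(j+1)} M_{\overline{1}}⋯M_{\overline{j+1}})`. -/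
def MwedgeF {K : Type*} [Field K] {A : Type*} [Ring A] [Algebra K A] {N : ℕ}
    (q : K) (R F Ψ : M2 N K) (M : Matrix (Fin N) (Fin N) A) (j : ℕ) : Op N A 1 :=
  qtrs (Dmat Ψ) 1 j
    ((qasym q R (1 + j) 0 (j + 1)).map (algebraMap K A) *
      MbarSeg (1 + j) (F.map (algebraMap K A)) ((F⁻¹).map (algebraMap K A)) M 0 (j + 1))

/-- The `(j+1)`-st symmetric power of `M`,
`M^{S(j+1)} = Tr_F(2,…,j+1)(S^{(j+1)} M_{\overline{1}}⋯M_{\overline{j+1}})`. -/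
def MsymF {K : Type*} [Field K] {A : Type*} [Ring A] [Algebra K A] {N : ℕ}
    (q : K) (R F Ψ : M2 N K) (M : Matrix (Fin N) (Fin N) A) (j : ℕ) : Op N A 1 :=
  qtrs (Dmat Ψ) 1 j
    ((qsym q R (1 + j) 0 (j + 1)).map (algebraMap K A) *
      MbarSeg (1 + j) (F.map (algebraMap K A)) ((F⁻¹).map (algebraMap K A)) M 0 (j + 1))

/-- `M^{\overline{0}} := q^{-n} n_q Tr_{(2,…,n)}(A^{(n)}) D^{-1}`, with `n = n0 + 1`
(an ordinary, non-quantum, trace over the factors `2,…,n`). -/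
def MzeroF {K : Type*} [Field K] {N : ℕ} (q : K) (R Ψ : M2 N K) (n0 : ℕ) :
    Op N K 1 :=
  (q⁻¹ ^ (n0 + 1) * qInt q (n0 + 1)) •
    (ptrs 1 n0 (qasym q R (1 + n0) 0 (n0 + 1)) * site1 1 0 ((Dmat Ψ)⁻¹))

/-- The generators of the characteristic subalgebra: all elements
`α(Y^{(k)}) = Tr_F(1,…,k)(Y^{(k)} M_{\overline{1}}⋯M_{\overline{k}})`, `k ≥ 1`. -/
def charSet {K : Type*} [Field K] {A : Type*} [Ring A] [Algebra K A] {N : ℕ}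
    (R F Ψ : M2 N K) (M : Matrix (Fin N) (Fin N) A) : Set A :=
  { x : A | ∃ (v : ℕ) (Y : FreeAlgebra K (Fin v)),
      x = qtrAll (Dmat Ψ)
        (evalY (R.map (algebraMap K A)) 0 Y *
          MbarSeg (v + 1) (F.map (algebraMap K A)) ((F⁻¹).map (algebraMap K A)) M 0 (v + 1)) }

end

section Embedding

variable {A : Type*} [Ring A] {N : ℕ}

open Classical in
/-- The operator acting as `X` on the tensor factors in the image of `e` and as the identity
on the others. -/
noncomputable def embed {k m : ℕ} (e : Fin k → Fin m) (X : Op N A k) : Op N A m :=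
  fun a b => if ∀ j, j ∉ Set.range e → a j = b j then X (a ∘ e) (b ∘ e) else 0

open Classical in
theorem sum_ite_eq_sum_extend {B : Type*} [AddCommMonoid B] {k m : ℕ} {e : Fin k → Fin m}
    (he : Function.Injective e) (a : Fin m → Fin N) (f : (Fin m → Fin N) → B) :
    (∑ c, if ∀ j, j ∉ Set.range e → c j = a j then f c else 0) =
      ∑ d : Fin k → Fin N, f (Function.extend e d a) := by
  rw [← Finset.sum_filter]
  have key : ∀ c : Fin m → Fin N, (∀ j, j ∉ Set.range e → c j = a j) →
      Function.extend e (c ∘ e) a = c := by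
    intro c hc
    funext j
    by_cases hj : j ∈ Set.range e
    · obtain ⟨i, rfl⟩ := hj
      rw [he.extend_apply]; rfl
    · rw [Function.extend_apply' _ _ _ hj, hc j hj]
  refine Finset.sum_nbij' (fun c => c ∘ e) (fun d => Function.extend e d a) ?_ ?_ ?_ ?_ ?_
  · simp
  · intro d _
    simp only [Finset.mem_filter, Finset.mem_univ, true_and]
    exact fun j hj => Function.extend_apply' _ _ _ hj
  · intro c hc
    exact key c (by simpa using hc)
  · intro d _
    exact Function.extend_comp he d a
  · intro c hc
    rw [key c (by simpa using hc)]

theorem embed_mul_apply {k m : ℕ} {e : Fin k → Fin m} (he : Function.Injective e)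
    (X : Op N A k) (Y : Op N A m) (a b : Fin m → Fin N) :
    (embed e X * Y) a b = ∑ d, X (a ∘ e) d * Y (Function.extend e d a) b := by
  classical
  have := sum_ite_eq_sum_extend he a (fun c => X (a ∘ e) (c ∘ e) * Y c b)
  simp only [Function.extend_comp he] at this
  rw [← this, Matrix.mul_apply]
  refine Finset.sum_congr rfl fun c _ => ?_
  simp only [embed, eq_comm, ite_mul, zero_mul]

theorem mul_embed_apply {k m : ℕ} {e : Fin k → Fin m} (he : Function.Injective e)
    (X : Op N A k) (Y : Op N A m) (a b : Fin m → Fin N) :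
    (Y * embed e X) a b = ∑ d, Y a (Function.extend e d b) * X d (b ∘ e) := by
  classical
  have := sum_ite_eq_sum_extend he b (fun c => Y a c * X (c ∘ e) (b ∘ e))
  simp only [Function.extend_comp he] at this
  rw [← this, Matrix.mul_apply]
  refine Finset.sum_congr rfl fun c _ => ?_
  simp only [embed, mul_ite, mul_zero]

theorem embed_mul {k m : ℕ} {e : Fin k → Fin m} (he : Function.Injective e) (X Y : Op N A k) :
    embed e (X * Y) = embed e X * embed e Y := by
  ext a b
  rw [embed_mul_apply he]
  have : ∀ d, (∀ j, j ∉ Set.range e → Function.extend e d a j = b j) ↔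
      ∀ j, j ∉ Set.range e → a j = b j := fun d =>
    forall₂_congr fun j hj => by rw [Function.extend_apply' _ _ _ hj]
  simp only [embed, this, Function.extend_comp he]
  split_ifs <;> simp [Matrix.mul_apply]

theorem embed_one {k m : ℕ} (e : Fin k → Fin m) :
    embed e (1 : Op N A k) = 1 := by
  ext a b
  simp only [embed, Matrix.one_apply]
  by_cases h : a = b
  · simp [h]
  · rw [if_neg h]
    split_ifs with h1 h2
    · refine absurd (funext fun j => ?_) h
      by_cases hj : j ∈ Set.range e
      · obtain ⟨i, rfl⟩ := hj
        exact congrFun h2 i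
      · exact h1 j hj
    · rfl
    · rfl

theorem embed_embed {k l m : ℕ} {e : Fin l → Fin m} (he : Function.Injective e)
    (e' : Fin k → Fin l) (X : Op N A k) : embed e (embed e' X) = embed (e ∘ e') X := by
  ext a b
  have : (∀ j, j ∉ Set.range (e ∘ e') → a j = b j) ↔
      (∀ j, j ∉ Set.range e → a j = b j) ∧ ∀ j, j ∉ Set.range e' → (a ∘ e) j = (b ∘ e) j := by
    refine ⟨fun h => ⟨fun j hj => h j ?_, fun j hj => h (e j) ?_⟩, fun h j hj => ?_⟩
    · rintro ⟨i, rfl⟩; exact hj ⟨e' i, rfl⟩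
    · rintro ⟨i, hi⟩; exact hj ⟨i, he hi⟩
    · by_cases hj' : j ∈ Set.range e
      · obtain ⟨i, rfl⟩ := hj'
        refine h.2 i ?_
        rintro ⟨t, rfl⟩
        exact hj ⟨t, rfl⟩
      · exact h.1 j hj'
  simp only [embed, this, ite_and]
  rfl

theorem embed_add {k m : ℕ} (e : Fin k → Fin m) (X Y : Op N A k) :
    embed e (X + Y) = embed e X + embed e Y := by
  ext a b
  simp only [embed, Matrix.add_apply]
  split_ifs <;> simp

theorem embed_smul {K : Type*} [Field K] [Algebra K A] {k m : ℕ} (e : Fin k → Fin m) (r : K)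
    (X : Op N A k) : embed e (r • X) = r • embed e X := by
  ext a b
  simp only [embed, Matrix.smul_apply]
  split_ifs <;> simp

/-- `embed e` as a homomorphism of algebras. -/
noncomputable def embedHom (K : Type*) [Field K] [Algebra K A] {k m : ℕ} {e : Fin k → Fin m}
    (he : Function.Injective e) : Op N A k →ₐ[K] Op N A m where
  toFun := embed e
  map_one' := embed_one e
  map_mul' := embed_mul he
  map_zero' := by ext a b; simp [embed]
  map_add' := embed_add e
  commutes' r := by
    rw [Algebra.algebraMap_eq_smul_one, embed_smul, embed_one, ← Algebra.algebraMap_eq_smul_one]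

theorem embed_mul_embed_apply {k l m : ℕ} {e : Fin k → Fin m} {e' : Fin l → Fin m}
    (he : Function.Injective e) (hd : ∀ i j, e i ≠ e' j) (X : Op N A k) (Y : Op N A l)
    (a b : Fin m → Fin N) [Decidable (∀ j, j ∉ Set.range e → j ∉ Set.range e' → a j = b j)] :
    (embed e X * embed e' Y) a b =
      if ∀ j, j ∉ Set.range e → j ∉ Set.range e' → a j = b j then
        X (a ∘ e) (b ∘ e) * Y (a ∘ e') (b ∘ e') else 0 := by
  classical
  rw [embed_mul_apply he]
  have h1 : ∀ d, Function.extend e d a ∘ e' = a ∘ e' := fun d => by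
    funext j
    exact Function.extend_apply' _ _ _ fun ⟨i, hi⟩ => hd i j hi
  have h2 : ∀ d, (∀ j, j ∉ Set.range e' → Function.extend e d a j = b j) ↔
      d = b ∘ e ∧ ∀ j, j ∉ Set.range e → j ∉ Set.range e' → a j = b j := by
    intro d
    constructor
    · intro h
      refine ⟨funext fun i => ?_, fun j hj hj' => ?_⟩
      · rw [Function.comp_apply, ← h (e i) (by rintro ⟨j, hj⟩; exact hd i j hj.symm),
          he.extend_apply]
      · rw [← h j hj', Function.extend_apply' _ _ _ hj]
    · rintro ⟨rfl, h⟩ j hj'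
      by_cases hj : j ∈ Set.range e
      · obtain ⟨i, rfl⟩ := hj
        rw [he.extend_apply]; rfl
      · rw [Function.extend_apply' _ _ _ hj, h j hj hj']
  simp only [embed, h1, h2, ite_and, mul_ite, mul_zero, Finset.sum_ite_eq', Finset.mem_univ,
    if_true]

theorem commute_embed {K : Type*} [Field K] [Algebra K A] {k l m : ℕ} {e : Fin k → Fin m}
    {e' : Fin l → Fin m} (he : Function.Injective e) (he' : Function.Injective e')
    (hd : ∀ i j, e i ≠ e' j) (X : Op N K k) (Y : Op N A l) :
    Commute (embed e (X.map (algebraMap K A))) (embed e' Y) := by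
  classical
  ext a b
  rw [embed_mul_embed_apply he hd, embed_mul_embed_apply he' fun i j => (hd j i).symm]
  refine if_congr ⟨fun h j h1 h2 => h j h2 h1, fun h j h1 h2 => h j h2 h1⟩ ?_ rfl
  exact (Algebra.commutes _ _)

end Embedding

section Sites

variable {K : Type*} [Field K] {A : Type*} [Ring A] [Algebra K A] {N : ℕ}

/-- A two-site operator, seen as an operator on `V^{⊗2}`. -/
def pairOp (X : M2 N A) : Op N A 2 :=
  X.submatrix (finTwoArrowEquiv (Fin N)) (finTwoArrowEquiv (Fin N))

theorem injective_pair {m i : ℕ} (h : i + 1 < m) :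
    Function.Injective (![⟨i, Nat.lt_of_succ_lt h⟩, ⟨i + 1, h⟩] : Fin 2 → Fin m) := by
  intro x y
  fin_cases x <;> fin_cases y <;> simp

theorem site_eq_embed {m i : ℕ} (h : i + 1 < m) (X : M2 N A) :
    site m i X = embed ![⟨i, Nat.lt_of_succ_lt h⟩, ⟨i + 1, h⟩] (pairOp X) := by
  ext a b
  simp only [site, dif_pos h, embed, mul_ite, mul_one, mul_zero]
  refine if_congr (forall_congr' fun j => ?_) (by simp [pairOp]) rfl
  simp only [Fin.ext_iff, Set.mem_range, not_exists, Fin.forall_fin_two, Matrix.cons_val_zero,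
    Matrix.cons_val_one, and_imp]
  exact ⟨fun H h1 h2 => H (Ne.symm h1) (Ne.symm h2), fun H h1 h2 => H (Ne.symm h1) (Ne.symm h2)⟩

theorem site_of_le {m i : ℕ} (h : m ≤ i + 1) (X : M2 N A) : site m i X = 1 := by
  ext a b
  simp [site, Nat.not_lt.2 h, Matrix.one_apply]

theorem site1_eq_embed {m i : ℕ} (h : i < m) (X : Matrix (Fin N) (Fin N) A) :
    site1 m i X = embed (fun _ : Fin 1 => ⟨i, h⟩) (X.submatrix (· 0) (· 0)) := by
  ext a b
  simp only [site1, dif_pos h, embed, mul_ite, mul_one, mul_zero]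
  refine if_congr (forall_congr' fun j => ?_) (by simp) rfl
  simp [Fin.ext_iff, eq_comm]

theorem embed_site {k m p i : ℕ} {e : Fin k → Fin m} (he : ∀ j, (e j : ℕ) = p + j)
    (h : i + 1 < k) (X : M2 N A) : embed e (site k i X) = site m (p + i) X := by
  have hinj : Function.Injective e := fun x y hxy => by
    have := congrArg Fin.val hxy
    rw [he, he] at this
    exact Fin.ext (by omega)
  have hm : p + i + 1 < m := by
    have := (e ⟨i + 1, h⟩).2
    rw [he] at this
    exact this
  rw [site_eq_embed h, site_eq_embed hm, embed_embed hinj]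
  congr 1
  funext j
  fin_cases j <;> simp [Fin.ext_iff, he, add_assoc]

theorem embed_site1 {k m : ℕ} {e : Fin k → Fin m} (he : ∀ j, (e j : ℕ) = j)
    (h : 0 < k) (X : Matrix (Fin N) (Fin N) A) : embed e (site1 k 0 X) = site1 m 0 X := by
  have hinj : Function.Injective e := fun x y hxy => by
    have := congrArg Fin.val hxy
    rw [he, he] at this
    exact Fin.ext this
  have hm : 0 < m := Nat.zero_lt_of_lt (e ⟨0, h⟩).2
  rw [site1_eq_embed h, site1_eq_embed hm, embed_embed hinj]
  congr 1
  funext j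
  simp [Fin.ext_iff, he]

theorem site_mul (m i : ℕ) (X Y : M2 N A) : site m i (X * Y) = site m i X * site m i Y := by
  rcases lt_or_ge (i + 1) m with h | h
  · rw [site_eq_embed h, site_eq_embed h, site_eq_embed h, ← embed_mul (injective_pair h)]
    congr 1
    exact (Matrix.submatrix_mul_equiv X Y _ _ _).symm
  · simp [site_of_le h]

theorem site_one (m i : ℕ) : site m i (1 : M2 N A) = 1 := by
  rcases lt_or_ge (i + 1) m with h | h
  · rw [site_eq_embed h, pairOp, Matrix.submatrix_one_equiv, embed_one]
  · exact site_of_le h _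

theorem isUnit_site (m i : ℕ) {X : M2 N A} (hX : IsUnit X) : IsUnit (site m i X) := by
  let f : M2 N A →* Op N A m :=
    { toFun := site m i, map_one' := site_one m i, map_mul' := site_mul m i }
  exact hX.map f

theorem commute_site {m i j : ℕ} (hij : i + 1 < j ∨ j + 1 < i) (X : M2 N K) (Y : M2 N A) :
    Commute (site m i (X.map (algebraMap K A))) (site m j Y) := by
  rcases lt_or_ge (i + 1) m with hi | hi
  swap
  · rw [site_of_le hi]; exact Commute.one_left _
  rcases lt_or_ge (j + 1) m with hj | hj
  swap
  · rw [site_of_le hj]; exact Commute.one_right _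
  rw [site_eq_embed hi, site_eq_embed hj]
  refine commute_embed (injective_pair hi) (injective_pair hj) ?_ (pairOp X) _
  intro x y
  fin_cases x <;> fin_cases y <;> simp <;> omega

theorem commute_site_site1 {m i j : ℕ} (h1 : j ≠ i) (h2 : j ≠ i + 1) (X : M2 N K)
    (Y : Matrix (Fin N) (Fin N) A) :
    Commute (site m i (X.map (algebraMap K A))) (site1 m j Y) := by
  rcases lt_or_ge (i + 1) m with hi | hi
  swap
  · rw [site_of_le hi]; exact Commute.one_left _
  rcases lt_or_ge j m with hj | hj
  swap
  · have : site1 m j Y = 1 := by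
      ext a b
      simp [site1, Nat.not_lt.2 hj, Matrix.one_apply]
    rw [this]; exact Commute.one_right _
  rw [site_eq_embed hi, site1_eq_embed hj]
  refine commute_embed (injective_pair hi) (Function.injective_of_subsingleton _) ?_ (pairOp X) _
  intro x y
  fin_cases x <;> simp <;> omega

theorem site_map (m i : ℕ) (X : M2 N K) :
    site m i (X.map (algebraMap K A)) = (site m i X).map (algebraMap K A) := by
  ext a b
  simp only [site, Matrix.map_apply]
  split_ifs <;> simp

end Sites

section Intertwiners

theorem SemiconjBy.inv_of_mul_eq_one {G : Type*} [Monoid G] {a x y x' y' : G}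
    (h : SemiconjBy a x y) (hx : x * x' = 1) (hy : y' * y = 1) : SemiconjBy a x' y' := by
  have h' : a * x = y * a := h
  calc a * x' = y' * y * a * x' := by rw [hy, one_mul]
    _ = y' * (a * x) * x' := by rw [h', mul_assoc y']
    _ = y' * a := by rw [mul_assoc, mul_assoc, hx, mul_one]

theorem SemiconjBy.conj_of_isUnit {G : Type*} [Monoid G] {u a x y a' x' y' : G} (hu : IsUnit u)
    (ha : SemiconjBy u a a') (hx : SemiconjBy u x x') (hy : SemiconjBy u y y')
    (h : SemiconjBy a x y) : SemiconjBy a' x' y' := by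
  refine hu.mul_right_cancel ?_
  rw [← (ha.mul_right hx).eq, ← (hy.mul_right ha).eq, h.eq]

variable {K : Type*} [Field K] {A : Type*} [Ring A] [Algebra K A] {N : ℕ}

/-- A two-site operator over the base field, placed at the sites `i, i+1` of `V^{⊗m}` and
regarded as an operator with entries in `A`. -/
noncomputable abbrev ksite (A : Type*) [Ring A] [Algebra K A] (m i : ℕ) (X : M2 N K) : Op N A m :=
  site m i (X.map (algebraMap K A))

theorem ksite_mul (m i : ℕ) (X Y : M2 N K) :
    ksite A m i (X * Y) = ksite A m i X * ksite A m i Y := by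
  rw [ksite, Matrix.map_mul, site_mul]

theorem ksite_one (m i : ℕ) : ksite A m i (1 : M2 N K) = 1 := by
  rw [ksite, Matrix.map_one _ (map_zero _) (map_one _), site_one]

theorem isUnit_ksite (m i : ℕ) {X : M2 N K} (hX : IsUnit X) : IsUnit (ksite A m i X) :=
  isUnit_site m i (hX.map (algebraMap K A).mapMatrix)

theorem ksite_mul_inv (m i : ℕ) {X : M2 N K} (hX : IsUnit X) :
    ksite A m i X * ksite A m i X⁻¹ = 1 := by
  rw [← ksite_mul, Matrix.mul_nonsing_inv _ ((Matrix.isUnit_iff_isUnit_det X).1 hX), ksite_one]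

theorem ksite_inv_mul (m i : ℕ) {X : M2 N K} (hX : IsUnit X) :
    ksite A m i X⁻¹ * ksite A m i X = 1 := by
  rw [← ksite_mul, Matrix.nonsing_inv_mul _ ((Matrix.isUnit_iff_isUnit_det X).1 hX), ksite_one]

theorem ksite_self (m i : ℕ) (X : M2 N K) : ksite K m i X = site m i X := by
  rw [ksite]; congr 1

/-- The two-site operator `X` can be moved across a third strand by means of `F`. -/
structure Natural (F X : M2 N K) : Prop where
  up : SemiconjBy (ksite K 3 0 F * ksite K 3 1 F) (ksite K 3 0 X) (ksite K 3 1 X)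
  down : SemiconjBy (ksite K 3 1 F * ksite K 3 0 F) (ksite K 3 1 X) (ksite K 3 0 X)

theorem Natural.of_yb {X : M2 N K} (h : YB X) : Natural X X := by
  unfold YB at h
  constructor <;> simp only [ksite_self, SemiconjBy]
  · rw [h, mul_assoc]
  · rw [← h, mul_assoc]

theorem Compatible.natural {R F : M2 N K} (h : Compatible R F) : Natural F R := by
  obtain ⟨-, -, h1, h2⟩ := h
  constructor <;> simp only [ksite_self, SemiconjBy]
  · rw [h2, mul_assoc]
  · rw [← h1, mul_assoc]

theorem Natural.mul {F X Y : M2 N K} (hX : Natural F X) (hY : Natural F Y) :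
    Natural F (X * Y) := by
  constructor <;> simp only [ksite_mul]
  · exact hX.up.mul_right hY.up
  · exact hX.down.mul_right hY.down

theorem Natural.inv {F X : M2 N K} (h : Natural F X) (hX : IsUnit X) : Natural F X⁻¹ :=
  ⟨SemiconjBy.inv_of_mul_eq_one h.up (ksite_mul_inv _ _ hX) (ksite_inv_mul _ _ hX),
    SemiconjBy.inv_of_mul_eq_one h.down (ksite_mul_inv _ _ hX) (ksite_inv_mul _ _ hX)⟩

theorem Natural.rff {R F : M2 N K} (hF : IsUnit F) (h : Compatible R F) :
    Natural F (RFF R F) := by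
  have h1 := Natural.of_yb h.2.1
  have h2 := h1.inv hF
  exact (h1.mul ((h1.mul h.natural).mul h2)).mul h2

section Transfer

variable {m j : ℕ}

/-- The factors `j, j+1, j+2` of `V^{⊗m}`. -/
def tripleEmb (hj : j + 2 < m) (t : Fin 3) : Fin m := ⟨j + t, by omega⟩

theorem tripleEmb_injective (hj : j + 2 < m) : Function.Injective (tripleEmb hj) := fun x y h => by
  simpa [tripleEmb, Fin.ext_iff] using h

theorem embed_ksite_map (hj : j + 2 < m) {i : ℕ} (hi : i + 1 < 3) (X : M2 N K) :
    embedHom K (tripleEmb_injective hj) ((algebraMap K A).mapMatrix (ksite K 3 i X)) =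
      ksite A m (j + i) X := by
  have : (algebraMap K A).mapMatrix (ksite K 3 i X) = site 3 i (X.map (algebraMap K A)) := by
    rw [ksite_self, site_map]; rfl
  rw [this]
  exact embed_site (fun _ => rfl) hi _

theorem Natural.up_site {F X : M2 N K} (h : Natural F X) (hj : j + 2 < m) :
    SemiconjBy (ksite A m j F * ksite A m (j + 1) F) (ksite A m j X) (ksite A m (j + 1) X) := by
  have := (h.up.map ((algebraMap K A).mapMatrix)).map (embedHom K (tripleEmb_injective hj))
  simp only [map_mul] at this
  rwa [embed_ksite_map hj (by norm_num), embed_ksite_map hj (by norm_num),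
    embed_ksite_map hj (by norm_num), embed_ksite_map hj (by norm_num)] at this

theorem Natural.down_site {F X : M2 N K} (h : Natural F X) (hj : j + 2 < m) :
    SemiconjBy (ksite A m (j + 1) F * ksite A m j F) (ksite A m (j + 1) X) (ksite A m j X) := by
  have := (h.down.map ((algebraMap K A).mapMatrix)).map (embedHom K (tripleEmb_injective hj))
  simp only [map_mul] at this
  rwa [embed_ksite_map hj (by norm_num), embed_ksite_map hj (by norm_num),
    embed_ksite_map hj (by norm_num), embed_ksite_map hj (by norm_num)] at this

end Transfer

variable {R F : M2 N K} {M : Matrix (Fin N) (Fin N) A} {m : ℕ}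

/-- The matrices `M_{\overline{j+1}}` of a pair `F, F⁻¹` over the base field. -/
noncomputable abbrev kMbar (m : ℕ) (F : M2 N K) (M : Matrix (Fin N) (Fin N) A) (j : ℕ) :
    Op N A m :=
  Mbar m (F.map (algebraMap K A)) ((F⁻¹).map (algebraMap K A)) M j

/-- The ordered products of `M_{\overline{j+1}}` of a pair `F, F⁻¹` over the base field. -/
noncomputable abbrev kMbarSeg (m : ℕ) (F : M2 N K) (M : Matrix (Fin N) (Fin N) A) (i l : ℕ) :
    Op N A m :=
  MbarSeg m (F.map (algebraMap K A)) ((F⁻¹).map (algebraMap K A)) M i l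

theorem semiconjBy_kMbar (hF : IsUnit F) (j : ℕ) :
    SemiconjBy (ksite A m j F) (kMbar m F M j) (kMbar m F M (j + 1)) := by
  change _ = ksite A m j F * kMbar m F M j * ksite A m j F⁻¹ * ksite A m j F
  rw [mul_assoc (_ * _), ksite_inv_mul _ _ hF, mul_one]

theorem commute_kMbar_of_lt (X : M2 N K) {j l : ℕ} (h : j < l) :
    Commute (ksite A m l X) (kMbar m F M j) := by
  induction j with
  | zero => exact commute_site_site1 (by omega) (by omega) _ _
  | succ j ih =>
    exact ((commute_site (by omega) _ _).mul_right (ih (by omega))).mul_right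
      (commute_site (by omega) _ _)

theorem commute_kMbar_of_gt {X : M2 N K} (hF : IsUnit F) (hX : Natural F X) {j l : ℕ}
    (h : l + 2 ≤ j) (hj : j < m) : Commute (ksite A m l X) (kMbar m F M j) := by
  induction j, h using Nat.le_induction with
  | base =>
    refine SemiconjBy.conj_of_isUnit
      ((isUnit_ksite m (l + 1) hF).mul (isUnit_ksite m l hF)) (hX.down_site hj)
      (SemiconjBy.mul_left (semiconjBy_kMbar hF (l + 1)) (semiconjBy_kMbar hF l))
      (SemiconjBy.mul_left (semiconjBy_kMbar hF (l + 1)) (semiconjBy_kMbar hF l))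
      (commute_kMbar_of_lt X (Nat.lt_succ_self l))
  | succ j hlj ih =>
    exact ((commute_site (by omega) _ _).mul_right (ih (by omega))).mul_right
      (commute_site (by omega) _ _)

theorem embed_kMbar {k : ℕ} {e : Fin k → Fin m} (he : ∀ j, (e j : ℕ) = j) {j : ℕ} (hj : j < k) :
    embed e (kMbar k F M j) = kMbar m F M j := by
  have hinj : Function.Injective e := fun x y hxy => by
    have := congrArg Fin.val hxy
    rw [he, he] at this
    exact Fin.ext this
  induction j with
  | zero => exact embed_site1 he hj M
  | succ j ih =>
    have hs : ∀ X : M2 N A, embed e (site k j X) = site m j X := fun X => by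
      rw [embed_site (p := 0) (fun t => by rw [he, zero_add]) hj, zero_add]
    simp only [kMbar, Mbar, embed_mul hinj, hs]
    rw [ih (by omega)]

theorem semiconjBy_kMbar_mul_kMbar (hF : IsUnit F) (h : Compatible R F)
    (hM : IsGenerators R F M) {j : ℕ} (hj : j + 1 < m) :
    SemiconjBy (kMbar m F M j * kMbar m F M (j + 1)) (ksite A m j (RFF R F))
      (ksite A m j R) := by
  induction j with
  | zero =>
    let e : Fin 2 → Fin m := Fin.castLE hj
    have he : ∀ j, (e j : ℕ) = j := fun j => rfl
    have hinj : Function.Injective e := Fin.castLE_injective hj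
    have := congrArg (embed e) hM
    have hs : ∀ X : M2 N A, embed e (site 2 0 X) = site m 0 X := fun X => by
      rw [embed_site (p := 0) (fun t => by rw [he, zero_add]) (by norm_num)]
    have h0 := embed_kMbar (F := F) (M := M) he (j := 0) (by norm_num)
    have h1 := embed_kMbar (F := F) (M := M) he (j := 1) (by norm_num)
    simp only [MbarSeg, one_mul, embed_mul hinj, hs, zero_add] at this
    rw [h0, h1] at this
    exact this.symm
  | succ j ih =>
    have hFn := Natural.of_yb h.2.1
    have hu : IsUnit (ksite A m j F * ksite A m (j + 1) F) :=
      (isUnit_ksite m j hF).mul (isUnit_ksite m (j + 1) hF)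
    have h1 : SemiconjBy (ksite A m j F * ksite A m (j + 1) F) (kMbar m F M j)
        (kMbar m F M (j + 1)) :=
      (semiconjBy_kMbar hF j).mul_left (commute_kMbar_of_lt F (Nat.lt_succ_self j))
    have h2 : SemiconjBy (ksite A m j F * ksite A m (j + 1) F) (kMbar m F M (j + 1))
        (kMbar m F M (j + 2)) :=
      SemiconjBy.mul_left (commute_kMbar_of_gt hF hFn le_rfl (by omega))
        (semiconjBy_kMbar hF (j + 1))
    exact SemiconjBy.conj_of_isUnit hu (h1.mul_right h2)
      ((Natural.rff hF h).up_site hj) (h.natural.up_site hj) (ih (by omega))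

theorem commute_kMbarSeg_of_lt (X : M2 N K) {l j : ℕ} (h : l ≤ j) :
    Commute (ksite A m j X) (kMbarSeg m F M 0 l) := by
  induction l with
  | zero => exact Commute.one_right _
  | succ l ih =>
    exact (ih (by omega)).mul_right (commute_kMbar_of_lt X (by omega))

theorem semiconjBy_kMbarSeg (hF : IsUnit F) (h : Compatible R F)
    (hM : IsGenerators R F M) {j l : ℕ} (hj : j + 2 ≤ l) (hl : l ≤ m) :
    SemiconjBy (kMbarSeg m F M 0 l) (ksite A m j (RFF R F)) (ksite A m j R) := by
  induction l, hj using Nat.le_induction with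
  | base =>
    simp only [kMbarSeg, MbarSeg, zero_add, mul_assoc]
    exact SemiconjBy.mul_left (commute_kMbarSeg_of_lt R le_rfl).symm
      (semiconjBy_kMbar_mul_kMbar hF h hM (by omega))
  | succ l hl' ih =>
    refine SemiconjBy.mul_left (ih (by omega)) ?_
    rw [zero_add]
    exact (commute_kMbar_of_gt hF (Natural.rff hF h) hl' (by omega)).symm

theorem kMbarSeg_add (i k l : ℕ) :
    kMbarSeg m F M i (k + l) = kMbarSeg m F M i k * kMbarSeg m F M (i + k) l := by
  induction l with
  | zero => exact (mul_one _).symm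
  | succ l ih =>
    change kMbarSeg m F M i (k + l) * kMbar m F M (i + (k + l)) =
      _ * (kMbarSeg m F M (i + k) l * kMbar m F M (i + k + l))
    rw [ih, mul_assoc, add_assoc]

end Intertwiners

section Chains

variable {K : Type*} [Field K] {A : Type*} [Ring A] [Algebra K A] {N : ℕ}
variable {R F : M2 N K} {M : Matrix (Fin N) (Fin N) A} {m : ℕ}

/-- The product `X_p X_{p+1} ⋯ X_{p+l-1}` for `X` over the base field. -/
noncomputable abbrev kchain (A : Type*) [Ring A] [Algebra K A] (m : ℕ) (X : M2 N K) (p l : ℕ) :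
    Op N A m :=
  chain m (X.map (algebraMap K A)) p l

theorem commute_kchain {X Y : M2 N K} {p l q : ℕ} (h : ∀ t < l, p + t + 1 < q ∨ q + 1 < p + t) :
    Commute (kchain A m X p l) (ksite A m q Y) := by
  induction l with
  | zero => exact Commute.one_left _
  | succ l ih =>
    exact (ih fun t ht => h t (by omega)).mul_left (commute_site (h l (by omega)) _ _)

theorem semiconjBy_kchain {X : M2 N K} (hX : Natural F X) {p l j : ℕ} (h1 : p ≤ j)
    (h2 : j + 1 < p + l) (h3 : p + l < m) :
    SemiconjBy (kchain A m F p l) (ksite A m j X) (ksite A m (j + 1) X) := by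
  induction l with
  | zero => omega
  | succ l ih =>
    rcases Nat.lt_or_ge (j + 1) (p + l) with h | h
    · exact (ih h (by omega)).mul_left (commute_site (Or.inr h) _ _)
    · obtain ⟨l, rfl⟩ : ∃ l', l = l' + 1 := ⟨l - 1, by omega⟩
      obtain rfl : j = p + l := by omega
      change SemiconjBy (kchain A m F p l * ksite A m (p + l) F * ksite A m (p + l + 1) F) _ _
      rw [mul_assoc]
      exact (commute_kchain fun t ht => by omega).semiconjBy.mul_left (hX.up_site (by omega))

theorem semiconjBy_kchain_kMbar (hF : IsUnit F) (hFF : Natural F F) {p l j : ℕ} (h1 : p ≤ j)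
    (h2 : j < p + l) (h3 : p + l < m) :
    SemiconjBy (kchain A m F p l) (kMbar m F M j) (kMbar m F M (j + 1)) := by
  induction l with
  | zero => omega
  | succ l ih =>
    rcases Nat.lt_or_ge j (p + l) with h | h
    · exact (ih h (by omega)).mul_left (commute_kMbar_of_lt F h)
    · obtain rfl : j = p + l := by omega
      refine SemiconjBy.mul_left ?_ (semiconjBy_kMbar hF (p + l))
      have : ∀ t ≤ l, Commute (kchain A m F p t) (kMbar m F M (p + l + 1)) := by
        intro t ht
        induction t with
        | zero => exact Commute.one_left _
        | succ t iht =>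
          exact (iht (by omega)).mul_left (commute_kMbar_of_gt hF hFF (by omega) (by omega))
      exact this l le_rfl

theorem semiconjBy_kchain_kMbarSeg (hF : IsUnit F) (hFF : Natural F F) {p l : ℕ}
    (h : p + l < m) {t : ℕ} (ht : t ≤ l) :
    SemiconjBy (kchain A m F p l) (kMbarSeg m F M p t) (kMbarSeg m F M (p + 1) t) := by
  induction t with
  | zero => exact SemiconjBy.one_right _
  | succ t ih =>
    refine (ih (by omega)).mul_right ?_
    rw [add_right_comm]
    exact semiconjBy_kchain_kMbar hF hFF (by omega) (by omega) h

theorem isUnit_kchain {X : M2 N K} (hX : IsUnit X) (p l : ℕ) : IsUnit (kchain A m X p l) := by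
  induction l with
  | zero => exact isUnit_one
  | succ l ih => exact ih.mul (isUnit_ksite m _ hX)

/-- The block braid of `k` strands past `l` strands, for `X` over the base field. -/
noncomputable abbrev kUstack (A : Type*) [Ring A] [Algebra K A] (m : ℕ) (X : M2 N K) (k l : ℕ) :
    Op N A m :=
  Ustack m (X.map (algebraMap K A)) k l

theorem isUnit_kUstack {X : M2 N K} (hX : IsUnit X) (k l : ℕ) :
    IsUnit (kUstack A m X k l) := by
  induction l with
  | zero => exact isUnit_one
  | succ l ih => exact (isUnit_kchain hX l k).mul ih

theorem commute_kUstack {X Y : M2 N K} {k l q : ℕ} (h : l + k ≤ q) :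
    Commute (kUstack A m X k l) (ksite A m q Y) := by
  induction l with
  | zero => exact Commute.one_left _
  | succ l ih =>
    exact (commute_kchain fun t ht => by omega).mul_left (ih (by omega))

theorem semiconjBy_kUstack_left (hR : Natural R R) {k l j : ℕ} (hj : j + 1 < k)
    (hm : l + k ≤ m) :
    SemiconjBy (kUstack A m R k l) (ksite A m j R) (ksite A m (l + j) R) := by
  induction l with
  | zero => rw [zero_add]; exact SemiconjBy.one_left _
  | succ l ih =>
    rw [add_right_comm]
    exact (semiconjBy_kchain hR (by omega) (by omega) (by omega)).mul_left (ih (by omega))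

theorem semiconjBy_kchain_mul_kchain (hR : Natural R R) {k j : ℕ} (hm : j + k + 1 < m) :
    SemiconjBy (kchain A m R (j + 1) k * kchain A m R j k) (ksite A m (j + k) R)
      (ksite A m j R) := by
  induction k with
  | zero => exact (SemiconjBy.one_left _).mul_left (SemiconjBy.one_left _)
  | succ k ih =>
    have hc : Commute (kchain A m R j k) (ksite A m (j + 1 + k) R) :=
      commute_kchain fun t ht => by omega
    have hd := hR.down_site (A := A) (m := m) (j := j + k) (by omega)
    have e : kchain A m R (j + 1) (k + 1) * kchain A m R j (k + 1) =
        (kchain A m R (j + 1) k * kchain A m R j k) *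
          (ksite A m (j + k + 1) R * ksite A m (j + k) R) := by
      change kchain A m R (j + 1) k * ksite A m (j + 1 + k) R *
        (kchain A m R j k * ksite A m (j + k) R) = _
      rw [mul_assoc, ← mul_assoc (ksite A m (j + 1 + k) R), ← hc.eq, add_right_comm j 1 k]
      simp only [mul_assoc]
    rw [e]
    exact (ih (by omega)).mul_left hd

theorem semiconjBy_kUstack_right (hR : Natural R R) {k l j : ℕ} (hj : j + 1 < l)
    (hm : l + k ≤ m) :
    SemiconjBy (kUstack A m R k l) (ksite A m (k + j) R) (ksite A m j R) := by
  induction l with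
  | zero => omega
  | succ l ih =>
    rcases Nat.lt_or_ge (j + 1) l with h | h
    · exact SemiconjBy.mul_left (commute_kchain fun t ht => by omega) (ih h (by omega))
    · obtain rfl : l = j + 1 := by omega
      change SemiconjBy (kchain A m R (j + 1) k * (kchain A m R j k * kUstack A m R k j)) _ _
      rw [← mul_assoc, add_comm k j]
      exact (semiconjBy_kchain_mul_kchain hR (by omega)).mul_left
        (commute_kUstack (by omega)).semiconjBy

/-- The polynomial `Y` evaluated at the operators `R_p, R_{p+1}, …` for `R` over the
base field. -/
noncomputable abbrev kevalY (A : Type*) [Ring A] [Algebra K A] (m : ℕ) (R : M2 N K) {v : ℕ}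
    (p : ℕ) (Y : FreeAlgebra K (Fin v)) : Op N A m :=
  evalY (R.map (algebraMap K A)) p Y

theorem semiconjBy_lift {B : Type*} [Ring B] [Algebra K B] {v : ℕ} {u : B} {f g : Fin v → B}
    (h : ∀ t, SemiconjBy u (f t) (g t)) (Y : FreeAlgebra K (Fin v)) :
    SemiconjBy u (FreeAlgebra.lift K f Y) (FreeAlgebra.lift K g Y) := by
  induction Y using FreeAlgebra.induction with
  | grade0 r =>
    rw [AlgHom.commutes, AlgHom.commutes]
    exact (Algebra.commute_algebraMap_left r u).symm
  | grade1 x => simpa using h x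
  | mul a b ha hb => rw [map_mul, map_mul]; exact ha.mul_right hb
  | add a b ha hb => rw [map_add, map_add]; exact ha.add_right hb

theorem semiconjBy_kevalY {v p q : ℕ} {u : Op N A m}
    (h : ∀ t < v, SemiconjBy u (ksite A m (p + t) R) (ksite A m (q + t) R))
    (Y : FreeAlgebra K (Fin v)) : SemiconjBy u (kevalY A m R p Y) (kevalY A m R q Y) :=
  semiconjBy_lift (fun t => h t t.2) Y

theorem embed_kevalY {k p q v : ℕ} {e : Fin k → Fin m} (he : ∀ j, (e j : ℕ) = p + j)
    (h : q + v < k) (Y : FreeAlgebra K (Fin v)) :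
    embed e (kevalY A k R q Y) = kevalY A m R (p + q) Y := by
  have hinj : Function.Injective e := fun x y hxy => by
    have := congrArg Fin.val hxy
    rw [he, he] at this
    exact Fin.ext (by omega)
  have : (embedHom K hinj).comp (FreeAlgebra.lift K fun t : Fin v => ksite A k (q + t) R) =
      FreeAlgebra.lift K fun t : Fin v => ksite A m (p + q + t) R := by
    refine FreeAlgebra.hom_ext (funext fun t => ?_)
    simp only [Function.comp_apply, AlgHom.comp_apply, FreeAlgebra.lift_ι_apply]
    rw [add_assoc]
    exact embed_site he (by omega) _
  exact DFunLike.congr_fun this Y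

theorem embed_kMbarSeg {k : ℕ} {e : Fin k → Fin m} (he : ∀ j, (e j : ℕ) = j) {i l : ℕ}
    (h : i + l ≤ k) : embed e (kMbarSeg k F M i l) = kMbarSeg m F M i l := by
  have hinj : Function.Injective e := fun x y hxy => by
    have := congrArg Fin.val hxy
    rw [he, he] at this
    exact Fin.ext this
  induction l with
  | zero => exact embed_one e
  | succ l ih =>
    simp only [kMbarSeg, MbarSeg, embed_mul hinj]
    rw [ih (by omega), embed_kMbar he (by omega)]

end Chains

section Traces

variable {K : Type*} [Field K] {A : Type*} [Ring A] [Algebra K A] {N : ℕ}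

theorem snoc_comp_castSucc {m : ℕ} (a : Fin m → Fin N) (e : Fin N) :
    (Fin.snoc a e : Fin (m + 1) → Fin N) ∘ Fin.castSucc = a := by
  funext j
  simp

theorem extend_castSucc_snoc {m : ℕ} (a d : Fin m → Fin N) (e : Fin N) :
    Function.extend Fin.castSucc d (Fin.snoc a e : Fin (m + 1) → Fin N) = Fin.snoc d e := by
  funext j
  refine Fin.lastCases ?_ (fun i => ?_) j
  · rw [Function.extend_apply' _ _ _ fun ⟨i, hi⟩ => (Fin.castSucc_lt_last i).ne hi]
    simp
  · rw [(Fin.castSucc_injective m).extend_apply]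
    simp

theorem qtr1_embed_mul {m : ℕ} (D : Matrix (Fin N) (Fin N) K) (P : Op N A m)
    (X : Op N A (m + 1)) : qtr1 D (embed Fin.castSucc P * X) = P * qtr1 D X := by
  ext a b
  simp only [qtr1, embed_mul_apply (Fin.castSucc_injective m), snoc_comp_castSucc,
    extend_castSucc_snoc, Matrix.mul_apply, Finset.mul_sum]
  rw [Finset.sum_comm_cycle]
  refine Finset.sum_congr rfl fun d _ => Finset.sum_congr rfl fun c _ =>
    Finset.sum_congr rfl fun e _ => ?_
  rw [← mul_assoc, ← mul_assoc, Algebra.commutes]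

theorem qtr1_mul_embed {m : ℕ} (D : Matrix (Fin N) (Fin N) K) (P : Op N A m)
    (X : Op N A (m + 1)) : qtr1 D (X * embed Fin.castSucc P) = qtr1 D X * P := by
  ext a b
  simp only [qtr1, mul_embed_apply (Fin.castSucc_injective m), snoc_comp_castSucc,
    extend_castSucc_snoc, Matrix.mul_apply, Finset.mul_sum, Finset.sum_mul]
  rw [Finset.sum_comm_cycle]
  refine Finset.sum_congr rfl fun d _ => Finset.sum_congr rfl fun c _ =>
    Finset.sum_congr rfl fun e _ => ?_
  rw [mul_assoc]

theorem qtrs_embed_mul {m j : ℕ} (D : Matrix (Fin N) (Fin N) K) (P : Op N A m)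
    (X : Op N A (m + j)) :
    qtrs D m j (embed (Fin.castLE (Nat.le_add_right m j)) P * X) = P * qtrs D m j X := by
  induction j with
  | zero =>
    have : embed (Fin.castLE (Nat.le_add_right m 0)) P = P := by
      ext a b
      have hr : ∀ j, j ∈ Set.range (Fin.castLE (Nat.le_add_right m 0)) := fun j => ⟨j, rfl⟩
      simp only [embed, hr, not_true_eq_false, false_imp_iff, implies_true, if_true]
      rfl
    exact congrArg (· * X) this
  | succ j ih =>
    have : embed (Fin.castLE (Nat.le_add_right m (j + 1))) P =
        embed Fin.castSucc (embed (Fin.castLE (Nat.le_add_right m j)) P) := by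
      rw [embed_embed (Fin.castSucc_injective _)]
      rfl
    change qtrs D m j (qtr1 D _) = P * qtrs D m j (qtr1 D X)
    rw [← ih, ← qtr1_embed_mul, ← this]

theorem sum_snoc {B : Type*} [AddCommMonoid B] {m : ℕ} (f : (Fin (m + 1) → Fin N) → B) :
    ∑ a, f a = ∑ a : Fin m → Fin N, ∑ c : Fin N, f (Fin.snoc a c) := by
  rw [← (Fin.snocEquiv fun _ => Fin N).sum_comp f, Fintype.sum_prod_type, Finset.sum_comm]
  rfl

theorem qtrAll_qtr1 {m : ℕ} (D : Matrix (Fin N) (Fin N) K) (X : Op N A (m + 1)) :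
    qtrAll D X = qtrAll D (qtr1 D X) := by
  simp only [qtrAll, qtr1, sum_snoc, Fin.prod_univ_castSucc, Fin.snoc_castSucc, Fin.snoc_last,
    Finset.mul_sum, map_mul]
  refine Finset.sum_congr rfl fun a _ => ?_
  rw [Finset.sum_comm]
  refine Finset.sum_congr rfl fun b _ => Finset.sum_congr rfl fun c _ =>
    Finset.sum_congr rfl fun e _ => ?_
  rw [mul_assoc]

theorem qtrAll_qtrs {m j : ℕ} (D : Matrix (Fin N) (Fin N) K) (X : Op N A (m + j)) :
    qtrAll D X = qtrAll D (qtrs D m j X) := by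
  induction j with
  | zero => rfl
  | succ j ih => exact (qtrAll_qtr1 D X).trans (ih (qtr1 D X))

theorem qtrAll_mul_scalar {m : ℕ} (D : Matrix (Fin N) (Fin N) K) (X : Op N A m) (x : A) :
    qtrAll D (X * Matrix.scalar _ x) = qtrAll D X * x := by
  simp [qtrAll, Matrix.scalar_apply, Matrix.mul_diagonal, Finset.sum_mul, mul_assoc]

theorem qtrAll_eq_trace {m : ℕ} (D : Matrix (Fin N) (Fin N) K) (X : Op N A m) :
    qtrAll D X = Matrix.trace ((Matrix.of fun a b : Fin m → Fin N =>
      ∏ i, D (a i) (b i)).map (algebraMap K A) * X) := by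
  simp [qtrAll, Matrix.trace, Matrix.mul_apply]

theorem trace_map_mul_comm {ι : Type*} [Fintype ι] (P : Matrix ι ι K) (X : Matrix ι ι A) :
    Matrix.trace (P.map (algebraMap K A) * X) = Matrix.trace (X * P.map (algebraMap K A)) := by
  simp only [Matrix.trace, Matrix.mul_apply, Matrix.diag_apply, Matrix.map_apply]
  rw [Finset.sum_comm]
  exact Finset.sum_congr rfl fun i _ => Finset.sum_congr rfl fun j _ => Algebra.commutes _ _

theorem prod_extend {k m : ℕ} {e : Fin k → Fin m} (he : Function.Injective e)
    (f : Fin m → K) :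
    ∏ i, f i = (∏ i ∈ Finset.univ.filter (· ∉ Set.range e), f i) * ∏ i, f (e i) := by
  classical
  rw [← Finset.prod_filter_not_mul_prod_filter Finset.univ (· ∈ Set.range e) f]
  congr 1
  · have : (Finset.univ.filter (· ∈ Set.range e)) = Finset.univ.map ⟨e, he⟩ := by
      ext; simp
    rw [this, Finset.prod_map]
    rfl

end Traces

section Skew

variable {K : Type*} [Field K] {A : Type*} [Ring A] [Algebra K A] {N : ℕ}

theorem extend_pair {m i : ℕ} (h : i + 1 < m) (d : Fin 2 → Fin N) (a : Fin m → Fin N) :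
    Function.extend ![⟨i, Nat.lt_of_succ_lt h⟩, ⟨i + 1, h⟩] d a =
      Function.update (Function.update a ⟨i, Nat.lt_of_succ_lt h⟩ (d 0)) ⟨i + 1, h⟩ (d 1) := by
  funext j
  by_cases h1 : j = ⟨i + 1, h⟩
  · subst h1
    rw [Function.update_self]
    exact (injective_pair h).extend_apply d a 1
  · rw [Function.update_of_ne h1]
    by_cases h0 : j = ⟨i, Nat.lt_of_succ_lt h⟩
    · subst h0
      rw [Function.update_self]
      exact (injective_pair h).extend_apply d a 0
    · rw [Function.update_of_ne h0, Function.extend_apply']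
      rintro ⟨t, rfl⟩
      fin_cases t
      · exact h0 rfl
      · exact h1 rfl

theorem sum_fin_two {B : Type*} [AddCommMonoid B] (f : (Fin 2 → Fin N) → B) :
    ∑ d, f d = ∑ p, ∑ q, f ![p, q] := by
  rw [← (finTwoArrowEquiv (Fin N)).symm.sum_comp f, Fintype.sum_prod_type]
  rfl

theorem site_mul_apply {m i : ℕ} (h : i + 1 < m) (X : M2 N A) (Y : Op N A m)
    (a b : Fin m → Fin N) :
    (site m i X * Y) a b = ∑ p, ∑ q,
      X (a ⟨i, Nat.lt_of_succ_lt h⟩, a ⟨i + 1, h⟩) (p, q) *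
        Y (Function.update (Function.update a ⟨i, Nat.lt_of_succ_lt h⟩ p) ⟨i + 1, h⟩ q) b := by
  rw [site_eq_embed h, embed_mul_apply (injective_pair h), sum_fin_two]
  simp only [extend_pair]
  rfl

theorem mul_site_apply {m i : ℕ} (h : i + 1 < m) (X : M2 N A) (Y : Op N A m)
    (a b : Fin m → Fin N) :
    (Y * site m i X) a b = ∑ p, ∑ q,
      Y a (Function.update (Function.update b ⟨i, Nat.lt_of_succ_lt h⟩ p) ⟨i + 1, h⟩ q) *
        X (p, q) (b ⟨i, Nat.lt_of_succ_lt h⟩, b ⟨i + 1, h⟩) := by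
  rw [site_eq_embed h, mul_embed_apply (injective_pair h), sum_fin_two]
  simp only [extend_pair]
  rfl

theorem IsClosedPair.mul_eq_one {F Ψ : M2 N K} (h : IsClosedPair F Ψ) :
    (Matrix.of fun s t => Ψ (s.1, t.1) (s.2, t.2) : M2 N K) *
      Matrix.of (fun s t => F (s.2, t.2) (s.1, t.1)) = 1 := by
  ext ⟨a, c⟩ ⟨d, b⟩
  rw [Matrix.mul_apply, Fintype.sum_prod_type, Matrix.one_apply]
  refine (h a b c d).trans (if_congr ?_ rfl rfl)
  rw [Prod.mk.injEq, eq_comm (a := b)]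

theorem IsClosedPair.skew {F Ψ : M2 N K} (h : IsClosedPair F Ψ) (f f' g g' : Fin N) :
    (∑ d, ∑ b, F (g, b) (f, d) * Ψ (d, f') (b, g')) = if f = f' ∧ g = g' then 1 else 0 := by
  have := mul_eq_one_comm.1 h.mul_eq_one
  replace this := congrFun (congrFun this (f, g)) (f', g')
  rw [Matrix.mul_apply, Fintype.sum_prod_type, Matrix.one_apply] at this
  simpa only [Prod.mk.injEq, Matrix.of_apply] using this

theorem IsClosedPair.sum_mul_Dmat {F Ψ : M2 N K} (h : IsClosedPair F Ψ) (f g : Fin N) :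
    (∑ d, ∑ b, F (g, b) (f, d) * Dmat Ψ d b) = if f = g then 1 else 0 := by
  have key : ∀ t, (∑ d, ∑ b, F (g, b) (f, d) * Ψ (d, t) (b, t)) =
      if f = t ∧ g = t then 1 else 0 := fun t => h.skew f t g t
  simp only [Dmat, Finset.mul_sum]
  rw [Finset.sum_comm_cycle]
  simp only [key]
  by_cases hfg : f = g
  · subst hfg; simp
  · rw [if_neg hfg]
    refine Finset.sum_eq_zero fun t _ => if_neg ?_
    rintro ⟨rfl, rfl⟩
    exact hfg rfl

theorem IsClosedPair.ext_of_sum {F Ψ : M2 N K} (h : IsClosedPair F Ψ) {u v : Fin N → Fin N → K}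
    (huv : ∀ a x, ∑ p, ∑ r, F (a, p) (x, r) * u p r = ∑ p, ∑ r, F (a, p) (x, r) * v p r) :
    u = v := by
  have hQ : (Matrix.of fun s t => F (s.2, t.2) (s.1, t.1) : M2 N K).mulVec (fun s => u s.2 s.1) =
      (Matrix.of fun s t => F (s.2, t.2) (s.1, t.1) : M2 N K).mulVec (fun s => v s.2 s.1) := by
    ext ⟨x, a⟩
    simp only [Matrix.mulVec, dotProduct, Fintype.sum_prod_type, Matrix.of_apply]
    rw [Finset.sum_comm, huv a x, Finset.sum_comm]
  have := congrArg (Matrix.of fun s t => Ψ (s.1, t.1) (s.2, t.2) : M2 N K).mulVec hQ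
  rw [Matrix.mulVec_mulVec, Matrix.mulVec_mulVec, h.mul_eq_one, Matrix.one_mulVec,
    Matrix.one_mulVec] at this
  funext p r
  exact congrFun this (r, p)

theorem update_snoc_snoc {n : ℕ} (a : Fin n → Fin N) (p q p' q' : Fin N) (h : n < n + 2)
    (h' : n + 1 < n + 2) :
    Function.update (Function.update (Fin.snoc (Fin.snoc a p : Fin (n + 1) → Fin N) q :
      Fin (n + 2) → Fin N) ⟨n, h⟩ p') ⟨n + 1, h'⟩ q' =
      Fin.snoc (Fin.snoc a p' : Fin (n + 1) → Fin N) q' := by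
  have : (⟨n, h⟩ : Fin (n + 2)) = (Fin.last n).castSucc := rfl
  rw [this, ← Fin.snoc_update, Fin.update_snoc_last]
  exact Fin.update_snoc_last ..

theorem snoc_snoc_apply {n : ℕ} (a : Fin n → Fin N) (p q : Fin N) (h : n < n + 2) :
    (Fin.snoc (Fin.snoc a p : Fin (n + 1) → Fin N) q : Fin (n + 2) → Fin N) ⟨n, h⟩ = p := by
  have : (⟨n, h⟩ : Fin (n + 2)) = (Fin.last n).castSucc := rfl
  rw [this, Fin.snoc_castSucc, Fin.snoc_last]

theorem snoc_apply_last {m : ℕ} (a : Fin m → Fin N) (p : Fin N) (h : m < m + 1) :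
    (Fin.snoc a p : Fin (m + 1) → Fin N) ⟨m, h⟩ = p := Fin.snoc_last ..

theorem site_mul_apply_snoc {n : ℕ} (X : M2 N A) (Y : Op N A (n + 2)) (a : Fin n → Fin N)
    (s t : Fin N) (b : Fin (n + 2) → Fin N) :
    (site (n + 2) n X * Y) (Fin.snoc (Fin.snoc a s : Fin (n + 1) → Fin N) t) b =
      ∑ p, ∑ q, X (s, t) (p, q) * Y (Fin.snoc (Fin.snoc a p : Fin (n + 1) → Fin N) q) b := by
  rw [site_mul_apply (Nat.lt_succ_self _)]
  simp only [update_snoc_snoc, snoc_snoc_apply, snoc_apply_last]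

theorem mul_site_apply_snoc {n : ℕ} (X : M2 N A) (Y : Op N A (n + 2)) (b : Fin n → Fin N)
    (s t : Fin N) (a : Fin (n + 2) → Fin N) :
    (Y * site (n + 2) n X) a (Fin.snoc (Fin.snoc b s : Fin (n + 1) → Fin N) t) =
      ∑ p, ∑ q, Y a (Fin.snoc (Fin.snoc b p : Fin (n + 1) → Fin N) q) * X (p, q) (s, t) := by
  rw [mul_site_apply (Nat.lt_succ_self _)]
  simp only [update_snoc_snoc, snoc_snoc_apply, snoc_apply_last]

theorem snoc_eq_snoc_iff {m : ℕ} (a b : Fin m → Fin N) (s t : Fin N) :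
    (Fin.snoc a s : Fin (m + 1) → Fin N) = Fin.snoc b t ↔ s = t ∧ a = b := by
  rw [Fin.snoc_inj, and_comm]

theorem site_apply_snoc {n : ℕ} (X : M2 N A) (a b : Fin n → Fin N) (s t s' t' : Fin N) :
    site (n + 2) n X (Fin.snoc (Fin.snoc a s : Fin (n + 1) → Fin N) t)
      (Fin.snoc (Fin.snoc b s' : Fin (n + 1) → Fin N) t') =
        if a = b then X (s, t) (s', t') else 0 := by
  rw [← mul_one (site (n + 2) n X), site_mul_apply_snoc]
  simp only [Matrix.one_apply, snoc_eq_snoc_iff, mul_ite, mul_one, mul_zero]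
  by_cases hab : a = b <;> simp [hab, ite_and]

theorem embed_castSucc_apply_snoc {m : ℕ} (X : Op N A m) (a b : Fin m → Fin N) (s t : Fin N) :
    embed Fin.castSucc X (Fin.snoc a s : Fin (m + 1) → Fin N) (Fin.snoc b t) =
      if s = t then X a b else 0 := by
  rw [← mul_one (embed Fin.castSucc X), embed_mul_apply (Fin.castSucc_injective m)]
  simp only [extend_castSucc_snoc, snoc_comp_castSucc, Matrix.one_apply, snoc_eq_snoc_iff,
    mul_ite, mul_one, mul_zero]
  by_cases hst : s = t <;> simp [hst]

theorem exists_eq_snoc {m : ℕ} (a : Fin (m + 1) → Fin N) :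
    ∃ (a' : Fin m → Fin N) (s : Fin N), a = Fin.snoc a' s :=
  ⟨Fin.init a, a (Fin.last m), (Fin.snoc_init_self a).symm⟩

theorem IsClosedPair.qtr1_ksite {F Ψ : M2 N K} (h : IsClosedPair F Ψ) (n : ℕ) :
    qtr1 (Dmat Ψ) (ksite A (n + 2) n F) = 1 := by
  ext a b
  obtain ⟨a, s, rfl⟩ := exists_eq_snoc a
  obtain ⟨b, t, rfl⟩ := exists_eq_snoc b
  simp only [qtr1, site_apply_snoc, Matrix.map_apply, Matrix.one_apply, snoc_eq_snoc_iff]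
  by_cases hab : a = b
  · have := congrArg (algebraMap K A) (h.sum_mul_Dmat t s)
    simp only [map_sum, map_mul, mul_comm (F _ _), eq_comm (a := t)] at this
    simpa [hab, apply_ite (algebraMap K A)] using this
  · simp [hab]

/-- The components of the partial quantum trace of `F ⊗ F⁻¹`. -/
noncomputable def skewTrace (D : Matrix (Fin N) (Fin N) K) (F : M2 N K) (s t p r : Fin N) : K :=
  ∑ c, ∑ e, ∑ q, D c e * (F (s, e) (p, q) * F⁻¹ (r, q) (t, c))

theorem qtr1_conj_apply (D : Matrix (Fin N) (Fin N) K) (F : M2 N K) {n : ℕ}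
    (X : Op N A (n + 1)) (a b : Fin n → Fin N) (s t : Fin N) :
    qtr1 D (ksite A (n + 2) n F * (embed Fin.castSucc X * ksite A (n + 2) n F⁻¹))
        (Fin.snoc a s) (Fin.snoc b t) =
      ∑ p, ∑ r, algebraMap K A (skewTrace D F s t p r) * X (Fin.snoc a p) (Fin.snoc b r) := by
  simp only [qtr1, site_mul_apply_snoc, mul_site_apply_snoc, embed_castSucc_apply_snoc, ite_mul,
    zero_mul, Finset.sum_ite_eq, Finset.mem_univ, if_true, Finset.mul_sum, Finset.sum_mul,
    skewTrace, map_sum, map_mul, Matrix.map_apply]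
  rw [Finset.sum_comm_cycle]
  refine Finset.sum_congr rfl fun p _ => ?_
  simp_rw [fun c e => Finset.sum_comm (s := (Finset.univ : Finset (Fin N))) (t := Finset.univ)
    (f := fun q r => algebraMap K A (D c e) * (algebraMap K A (F (s, e) (p, q)) *
      (X (Fin.snoc a p) (Fin.snoc b r) * algebraMap K A (F⁻¹ (r, q) (t, c)))))]
  rw [Finset.sum_comm_cycle]
  refine Finset.sum_congr rfl fun r _ => Finset.sum_congr rfl fun c _ =>
    Finset.sum_congr rfl fun e _ => Finset.sum_congr rfl fun q _ => ?_
  rw [← Algebra.commutes (F⁻¹ _ _), mul_assoc, mul_assoc]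

theorem IsClosedPair.skewTrace_eq {F Ψ : M2 N K} (h : IsClosedPair F Ψ) (hF : IsUnit F)
    (hFF : YB F) (s t p r : Fin N) :
    skewTrace (Dmat Ψ) F s t p r = if s = t then Dmat Ψ r p else 0 := by
  have key : qtr1 (Dmat Ψ)
      (ksite K 3 1 F * (embed Fin.castSucc (ksite K 2 0 F) * ksite K 3 1 F⁻¹)) = 1 := by
    have h0 : ∀ X : M2 N K, embed Fin.castSucc (ksite K 2 0 X) = ksite K 3 0 X := fun X =>
      embed_site (k := 2) (m := 3) (p := 0) (i := 0) (e := Fin.castSucc)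
        (fun j => (Nat.zero_add _).symm) (by norm_num) _
    have h1 : ksite K 3 1 F * (embed Fin.castSucc (ksite K 2 0 F) * ksite K 3 1 F⁻¹) =
        embed Fin.castSucc (ksite K 2 0 F⁻¹) *
          (ksite K 3 1 F * embed Fin.castSucc (ksite K 2 0 F)) := by
      rw [h0, h0, ← mul_assoc]
      have h2 := (Natural.of_yb hFF).down.eq
      calc _ = ksite K 3 0 F⁻¹ * (ksite K 3 0 F * (ksite K 3 1 F * ksite K 3 0 F)) *
            ksite K 3 1 F⁻¹ := by rw [← mul_assoc, ksite_inv_mul _ _ hF, one_mul]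
        _ = _ := by rw [← h2, ← mul_assoc, mul_assoc, ksite_mul_inv _ _ hF, mul_one]
    rw [h1, qtr1_embed_mul, qtr1_mul_embed, h.qtr1_ksite 1, one_mul, ksite_inv_mul _ _ hF]
  refine congrFun (congrFun (h.ext_of_sum (u := skewTrace (Dmat Ψ) F s t)
    (v := fun p r => if s = t then Dmat Ψ r p else 0) fun a x => ?_) p) r
  have h2 := qtr1_conj_apply (Dmat Ψ) F (ksite K 2 0 F) (Fin.snoc Fin.elim0 a)
    (Fin.snoc Fin.elim0 x) s t
  rw [key, Matrix.one_apply] at h2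
  simp only [snoc_eq_snoc_iff, site_apply_snoc, Matrix.map_apply, Algebra.algebraMap_self,
    RingHom.id_apply, if_true, and_true] at h2
  simp only [mul_comm (F _ _)]
  rw [← h2]
  by_cases hst : s = t
  · have := h.sum_mul_Dmat x a
    rw [Finset.sum_comm] at this
    simp only [hst, true_and, if_true, mul_comm (Dmat Ψ _ _), this, eq_comm]
  · simp [hst]

theorem IsClosedPair.qtr1_conj {F Ψ : M2 N K} (h : IsClosedPair F Ψ) (hF : IsUnit F)
    (hFF : YB F) {n : ℕ} (X : Op N A (n + 1)) :
    qtr1 (Dmat Ψ) (ksite A (n + 2) n F * (embed Fin.castSucc X * ksite A (n + 2) n F⁻¹)) =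
      embed Fin.castSucc (qtr1 (Dmat Ψ) X) := by
  ext a b
  obtain ⟨a, s, rfl⟩ := exists_eq_snoc a
  obtain ⟨b, t, rfl⟩ := exists_eq_snoc b
  rw [qtr1_conj_apply, embed_castSucc_apply_snoc]
  simp only [h.skewTrace_eq hF hFF, qtr1]
  by_cases hst : s = t
  · simp only [hst, if_true]
    rw [Finset.sum_comm]
  · simp [hst]

end Skew

section Weight

variable {K : Type*} [Field K] {N : ℕ}

/-- Append two indices to a multi-index. -/
abbrev snocPair {n : ℕ} (a : Fin n → Fin N) (v : Fin N × Fin N) : Fin (n + 2) → Fin N :=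
  Fin.snoc (Fin.snoc a v.1 : Fin (n + 1) → Fin N) v.2

/-- The block of an operator with prescribed indices outside the last two tensor factors. -/
def lastBlock {n : ℕ} (Y : Op N K (n + 2)) (a b : Fin n → Fin N) : M2 N K :=
  fun v w => Y (snocPair a v) (snocPair b w)

/-- The trace over the last two tensor factors, weighted by `W`. -/
def wtr {n : ℕ} (W : M2 N K) (Y : Op N K (n + 2)) : Op N K n :=
  fun a b => Matrix.trace (W * lastBlock Y a b)

theorem wtr_apply {n : ℕ} (W : M2 N K) (Y : Op N K (n + 2)) (a b : Fin n → Fin N) :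
    wtr W Y a b = ∑ w, ∑ v, W w v * Y (snocPair a v) (snocPair b w) := by
  simp only [wtr, lastBlock, Matrix.trace, Matrix.diag_apply, Matrix.mul_apply]

theorem extend_castSucc_comp_snoc {n : ℕ} (a d : Fin n → Fin N) (v : Fin N × Fin N) :
    Function.extend (Fin.castSucc ∘ Fin.castSucc) d (snocPair a v) = snocPair d v := by
  funext j
  refine Fin.lastCases ?_ (fun i => Fin.lastCases ?_ (fun l => ?_) i) j
  · rw [Function.extend_apply']
    · simp
    · rintro ⟨l, hl⟩
      exact (Fin.castSucc_lt_last _).ne hl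
  · rw [Function.extend_apply']
    · simp
    · rintro ⟨l, hl⟩
      exact (Fin.castSucc_lt_last _).ne (Fin.castSucc_injective _ hl)
  · refine (((Fin.castSucc_injective _).comp
      (Fin.castSucc_injective n)).extend_apply _ _ l).trans ?_
    simp

theorem snocPair_comp {n : ℕ} (a : Fin n → Fin N) (v : Fin N × Fin N) :
    snocPair a v ∘ (Fin.castSucc ∘ Fin.castSucc) = a := by
  rw [← Function.comp_assoc, snoc_comp_castSucc, snoc_comp_castSucc]

theorem wtr_embed_mul {n : ℕ} (W : M2 N K) (P : Op N K n) (Y : Op N K (n + 2)) :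
    wtr W (embed (Fin.castSucc ∘ Fin.castSucc) P * Y) = P * wtr W Y := by
  ext a b
  simp only [wtr_apply,
    embed_mul_apply ((Fin.castSucc_injective _).comp (Fin.castSucc_injective n)),
    extend_castSucc_comp_snoc, Matrix.mul_apply, Finset.mul_sum, snocPair_comp]
  rw [Finset.sum_comm_cycle]
  refine Finset.sum_congr rfl fun d _ => Finset.sum_congr rfl fun c _ =>
    Finset.sum_congr rfl fun e _ => ?_
  ring

theorem wtr_mul_embed {n : ℕ} (W : M2 N K) (P : Op N K n) (Y : Op N K (n + 2)) :
    wtr W (Y * embed (Fin.castSucc ∘ Fin.castSucc) P) = wtr W Y * P := by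
  ext a b
  simp only [wtr_apply,
    mul_embed_apply ((Fin.castSucc_injective _).comp (Fin.castSucc_injective n)),
    extend_castSucc_comp_snoc, Matrix.mul_apply, Finset.mul_sum, Finset.sum_mul, snocPair_comp]
  rw [Finset.sum_comm_cycle]
  refine Finset.sum_congr rfl fun d _ => Finset.sum_congr rfl fun c _ =>
    Finset.sum_congr rfl fun e _ => ?_
  ring

theorem wtr_site_mul {n : ℕ} (W X : M2 N K) (Y : Op N K (n + 2)) :
    wtr W (site (n + 2) n X * Y) = wtr (W * X) Y := by
  ext a b
  have : lastBlock (site (n + 2) n X * Y) a b = X * lastBlock Y a b := by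
    ext v w
    rw [Matrix.mul_apply, Fintype.sum_prod_type]
    exact site_mul_apply_snoc X Y a v.1 v.2 _
  rw [wtr, wtr, this, mul_assoc]

theorem wtr_mul_site {n : ℕ} (W X : M2 N K) (Y : Op N K (n + 2)) :
    wtr W (Y * site (n + 2) n X) = wtr (X * W) Y := by
  ext a b
  have : lastBlock (Y * site (n + 2) n X) a b = lastBlock Y a b * X := by
    ext v w
    rw [Matrix.mul_apply, Fintype.sum_prod_type]
    exact mul_site_apply_snoc X Y b w.1 w.2 _
  rw [wtr, wtr, this, ← mul_assoc, Matrix.trace_mul_comm, mul_assoc]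

/-- The weight of the two-factor quantum trace. -/
def dweight (D : Matrix (Fin N) (Fin N) K) : M2 N K :=
  fun w v => D w.1 v.1 * D w.2 v.2

theorem wtr_dweight {n : ℕ} (D : Matrix (Fin N) (Fin N) K) (Y : Op N K (n + 2)) :
    wtr (dweight D) Y = qtr1 D (qtr1 D Y) := by
  ext a b
  simp only [wtr_apply, dweight, qtr1,
    Finset.mul_sum, Fintype.sum_prod_type, Algebra.algebraMap_self, RingHom.id_apply, mul_assoc]
  exact Finset.sum_congr rfl fun c _ => Finset.sum_comm

/-- The braiding of two pairs of strands. -/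
def pairBraid (F : M2 N K) : Op N K 4 :=
  site 4 1 F * (site 4 0 F * (site 4 2 F * site 4 1 F))

theorem site_four_zero_mul_apply (F : M2 N K) (Y : Op N K 4) (a b u t : Fin N)
    (v : Fin 4 → Fin N) :
    (site 4 0 F * Y) ![a, b, u, t] v = ∑ p, ∑ q, F (a, b) (p, q) * Y ![p, q, u, t] v := by
  rw [site_mul_apply (by norm_num)]
  refine Finset.sum_congr rfl fun p _ => Finset.sum_congr rfl fun q _ => ?_
  congr 2
  funext j; fin_cases j <;> rfl

theorem site_four_one_mul_apply (F : M2 N K) (Y : Op N K 4) (a b u t : Fin N)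
    (v : Fin 4 → Fin N) :
    (site 4 1 F * Y) ![a, b, u, t] v = ∑ p, ∑ q, F (b, u) (p, q) * Y ![a, p, q, t] v := by
  rw [site_mul_apply (by norm_num)]
  refine Finset.sum_congr rfl fun p _ => Finset.sum_congr rfl fun q _ => ?_
  congr 2
  funext j; fin_cases j <;> rfl

theorem site_four_two_mul_apply (F : M2 N K) (Y : Op N K 4) (a b u t : Fin N)
    (v : Fin 4 → Fin N) :
    (site 4 2 F * Y) ![a, b, u, t] v = ∑ p, ∑ q, F (u, t) (p, q) * Y ![a, b, p, q] v := by
  rw [site_mul_apply (by norm_num)]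
  refine Finset.sum_congr rfl fun p _ => Finset.sum_congr rfl fun q _ => ?_
  congr 2
  funext j; fin_cases j <;> rfl

theorem site_two_mul_site_one_apply (F : M2 N K) (a b u t x y c d : Fin N) :
    (site 4 2 F * site 4 1 F) ![a, b, u, t] ![x, y, c, d] =
      if a = x then ∑ s, F (u, t) (s, d) * F (b, s) (y, c) else 0 := by
  have h1 : ∀ s d' : Fin N, site 4 1 F ![a, b, s, d'] ![x, y, c, d] =
      if a = x then if d' = d then F (b, s) (y, c) else 0 else 0 := by
    intro s d'
    rw [site, dif_pos (by norm_num), mul_ite, mul_one, mul_zero, ← ite_and]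
    refine if_congr ?_ rfl rfl
    constructor
    · exact fun H => ⟨H 0 (by norm_num) (by norm_num), H 3 (by norm_num) (by norm_num)⟩
    · rintro ⟨rfl, rfl⟩ j h1 h2
      fin_cases j <;> simp_all
  simp only [site_four_two_mul_apply, h1]
  by_cases hax : a = x <;> simp [hax]

theorem wtr_pairBraid_apply (W F : M2 N K) (a b x y : Fin N) :
    wtr W (pairBraid F) ![a, b] ![x, y] =
      ∑ p, ∑ r, F (a, p) (x, r) * ∑ u, ∑ q, F (b, u) (p, q) * ∑ s, ∑ c, F (r, s) (y, c) *
        ∑ t, ∑ d, F (q, t) (s, d) * W (c, d) (u, t) := by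
  have hs : ∀ (a b : Fin N) (v : Fin N × Fin N), snocPair ![a, b] v = ![a, b, v.1, v.2] :=
    fun a b v => by funext j; fin_cases j <;> rfl
  simp only [wtr_apply, pairBraid, hs,
    site_four_zero_mul_apply, site_four_one_mul_apply, site_two_mul_site_one_apply, mul_ite,
    mul_zero, Finset.sum_ite_irrel, Finset.sum_const_zero, Finset.sum_ite_eq', Finset.mem_univ,
    if_true, Finset.mul_sum, Fintype.sum_prod_type]
  simp only [← Fintype.sum_prod_type']
  refine Fintype.sum_equiv ⟨fun z => (z.2.2.2.2.1, z.2.2.2.2.2.2.1, z.2.2.1, z.2.2.2.2.2.1,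
    z.2.2.2.2.2.2.2, z.1, z.2.2.2.1, z.2.1), fun z => (z.2.2.2.2.2.1, z.2.2.2.2.2.2.2, z.2.2.1,
    z.2.2.2.2.2.2.1, z.1, z.2.2.2.1, z.2.1, z.2.2.2.2.1), fun _ => rfl,
    fun _ => rfl⟩ _ _ fun z => ?_
  simp only [Equiv.coe_fn_mk]
  ring

end Weight

section WeightTwist

variable {K : Type*} [Field K] {A : Type*} [Ring A] [Algebra K A] {N : ℕ}

theorem embed_castSucc_site {m i : ℕ} (h : i + 1 < m) (X : M2 N A) :
    embed Fin.castSucc (site m i X) = site (m + 1) i X :=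
  (embed_site (p := 0) (e := Fin.castSucc) (fun _ => (Nat.zero_add _).symm) h X).trans
    (by rw [Nat.zero_add])

theorem embed_castSucc_comp_site (X : M2 N A) :
    embed (Fin.castSucc ∘ Fin.castSucc) (site 2 0 X) = site 4 0 X :=
  (embed_site (k := 2) (m := 4) (p := 0) (i := 0) (e := Fin.castSucc ∘ Fin.castSucc)
    (fun _ => (Nat.zero_add _).symm) (by norm_num) X).trans
    (by rw [Nat.zero_add])

theorem Natural.pairBraid_down {F X : M2 N K} (h : Natural F X) :
    SemiconjBy (pairBraid F) (site 4 2 X) (site 4 0 X) := by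
  have h1 := h.down_site (A := K) (m := 4) (j := 0) (by norm_num)
  have h2 := h.down_site (A := K) (m := 4) (j := 1) (by norm_num)
  simp only [ksite_self, zero_add] at h1 h2
  rw [pairBraid, ← mul_assoc]
  exact h1.mul_left h2

theorem Natural.pairBraid_up {F X : M2 N K} (h : Natural F X) :
    SemiconjBy (pairBraid F) (site 4 0 X) (site 4 2 X) := by
  have h1 := h.up_site (A := K) (m := 4) (j := 0) (by norm_num)
  have h2 := h.up_site (A := K) (m := 4) (j := 1) (by norm_num)
  simp only [ksite_self, zero_add] at h1 h2
  have hc : Commute (site 4 0 F) (site 4 2 F) := commute_site (Or.inl (by norm_num)) F F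
  rw [pairBraid, ← mul_assoc (site 4 0 F), hc.eq, mul_assoc (site 4 2 F), ← mul_assoc]
  exact h2.mul_left h1

theorem wtr_dweight_pairBraid {F Ψ : M2 N K} (h : IsClosedPair F Ψ) (hFF : YB F) :
    wtr (dweight (Dmat Ψ)) (pairBraid F) = site 2 0 F * site 2 0 F := by
  have h2 := h.qtr1_ksite (A := K) 2
  have h1 := h.qtr1_ksite (A := K) 1
  simp only [ksite_self] at h1 h2
  rw [wtr_dweight, pairBraid, ← mul_assoc, ← embed_castSucc_site (m := 3) (i := 0) (by norm_num),
    ← embed_castSucc_site (m := 3) (i := 1) (by norm_num),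
    ← embed_mul (Fin.castSucc_injective _), qtr1_embed_mul, qtr1_mul_embed, h2, one_mul,
    ← show _ = _ from hFF, ← embed_castSucc_site (m := 2) (i := 0) (by norm_num), mul_assoc,
    qtr1_embed_mul, qtr1_mul_embed, h1, one_mul]

theorem IsClosedPair.wtr_pairBraid_injective {F Ψ : M2 N K} (h : IsClosedPair F Ψ) :
    Function.Injective fun W : M2 N K => wtr W (pairBraid F) := by
  intro W W' hW
  have h1 : ∀ b y, _ := fun b y => h.ext_of_sum fun a x => by
    have := congrFun (congrFun hW ![a, b]) ![x, y]
    simp only [wtr_pairBraid_apply] at this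
    exact this
  have h2 : ∀ r y, _ := fun r y => h.ext_of_sum fun b p => congrFun (congrFun (h1 b y) p) r
  have h3 : ∀ u q, _ := fun u q => h.ext_of_sum fun r y => congrFun (congrFun (h2 r y) u) q
  have h4 : ∀ u c, _ := fun u c => h.ext_of_sum fun q s => congrFun (congrFun (h3 u q) s) c
  ext ⟨c, d⟩ ⟨u, t⟩
  exact congrFun (congrFun (h4 u c) t) d

/-- The weight `D ⊗ D` intertwines `X` with its double twist. -/
theorem IsClosedPair.dweight_mul {F Ψ X : M2 N K} (h : IsClosedPair F Ψ) (hF : IsUnit F)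
    (hFF : YB F) (hX : Natural F X) :
    dweight (Dmat Ψ) * X = RFF X F * dweight (Dmat Ψ) := by
  have hdet := (Matrix.isUnit_iff_isUnit_det F).1 hF
  have hi : Natural F F⁻¹ := (Natural.of_yb hFF).inv hF
  have hii := hi.mul hi
  have hE : wtr (F⁻¹ * F⁻¹ * dweight (Dmat Ψ)) (pairBraid F) = 1 := by
    rw [← wtr_mul_site, hii.pairBraid_down.eq, ← embed_castSucc_comp_site, wtr_embed_mul,
      wtr_dweight_pairBraid h hFF, ← site_mul, ← site_mul, mul_assoc,
      Matrix.nonsing_inv_mul_cancel_left _ _ hdet, Matrix.nonsing_inv_mul _ hdet, site_one]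
  have hc : F⁻¹ * F⁻¹ * dweight (Dmat Ψ) * X = X * (F⁻¹ * F⁻¹ * dweight (Dmat Ψ)) := by
    refine h.wtr_pairBraid_injective ?_
    change wtr _ _ = wtr _ _
    rw [← wtr_site_mul (F⁻¹ * F⁻¹ * dweight (Dmat Ψ)) X,
      ← wtr_mul_site (F⁻¹ * F⁻¹ * dweight (Dmat Ψ)) X, hX.pairBraid_down.eq, ← hX.pairBraid_up.eq,
      ← embed_castSucc_comp_site, wtr_embed_mul, wtr_mul_embed, hE, one_mul, mul_one]
  calc dweight (Dmat Ψ) * X = F * F * (F⁻¹ * F⁻¹ * dweight (Dmat Ψ) * X) := by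
        simp only [mul_assoc, Matrix.mul_nonsing_inv_cancel_left _ _ hdet]
    _ = RFF X F * dweight (Dmat Ψ) := by rw [hc, RFF]; simp only [mul_assoc]

/-- The weight of the full quantum trace on `V^{⊗m}`. -/
def qweight (D : Matrix (Fin N) (Fin N) K) (m : ℕ) : Op N K m :=
  Matrix.of fun a b => ∏ i, D (a i) (b i)

theorem qweight_mul_embed (D : Matrix (Fin N) (Fin N) K) {k m : ℕ} {e : Fin k → Fin m}
    (he : Function.Injective e) {X Y : Op N K k} (h : qweight D k * X = Y * qweight D k) :
    qweight D m * embed e X = embed e Y * qweight D m := by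
  ext a b
  have h' := congrFun (congrFun h (a ∘ e)) (b ∘ e)
  simp only [Matrix.mul_apply, qweight, Matrix.of_apply] at h'
  rw [mul_embed_apply he, embed_mul_apply he]
  have h1 : ∀ d, ∀ j ∈ Finset.univ.filter (· ∉ Set.range e), Function.extend e d b j = b j :=
    fun d j hj => Function.extend_apply' _ _ _ (by simpa using hj)
  have h2 : ∀ d, ∀ j ∈ Finset.univ.filter (· ∉ Set.range e), Function.extend e d a j = a j :=
    fun d j hj => Function.extend_apply' _ _ _ (by simpa using hj)
  have h3 : ∀ d, qweight D m a (Function.extend e d b) =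
      (∏ j ∈ Finset.univ.filter (· ∉ Set.range e), D (a j) (b j)) * ∏ i, D (a (e i)) (d i) := by
    intro d
    rw [qweight, Matrix.of_apply, prod_extend he]
    refine congrArg₂ _ (Finset.prod_congr rfl fun j hj => by rw [h1 d j hj]) ?_
    simp only [he.extend_apply]
  have h4 : ∀ d, qweight D m (Function.extend e d a) b =
      (∏ j ∈ Finset.univ.filter (· ∉ Set.range e), D (a j) (b j)) * ∏ i, D (d i) (b (e i)) := by
    intro d
    rw [qweight, Matrix.of_apply, prod_extend he]
    refine congrArg₂ _ (Finset.prod_congr rfl fun j hj => by rw [h2 d j hj]) ?_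
    simp only [he.extend_apply]
  simp only [h3, h4, mul_assoc, mul_left_comm (Y _ _), ← Finset.mul_sum]
  exact congrArg _ h'

theorem qweight_mul_site {F Ψ X : M2 N K} (h : IsClosedPair F Ψ) (hF : IsUnit F)
    (hFF : YB F) (hX : Natural F X) (m j : ℕ) :
    qweight (Dmat Ψ) m * site m j X = site m j (RFF X F) * qweight (Dmat Ψ) m := by
  by_cases hj : j + 1 < m
  · rw [site_eq_embed hj, site_eq_embed hj]
    refine qweight_mul_embed _ (injective_pair hj) ?_
    have hq : qweight (Dmat Ψ) 2 = pairOp (dweight (Dmat Ψ)) := by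
      ext a b
      simp [qweight, pairOp, dweight, Fin.prod_univ_two]
    rw [hq, pairOp, pairOp, pairOp, Matrix.submatrix_mul_equiv, Matrix.submatrix_mul_equiv,
      h.dweight_mul hF hFF hX]
  · rw [site_of_le (not_lt.1 hj), site_of_le (not_lt.1 hj), one_mul, mul_one]

theorem qtrAll_ksite_mul {F Ψ X : M2 N K} (h : IsClosedPair F Ψ) (hF : IsUnit F)
    (hFF : YB F) (hX : Natural F X) {m : ℕ} (j : ℕ) (Y : Op N A m) :
    qtrAll (Dmat Ψ) (ksite A m j X * Y) = qtrAll (Dmat Ψ) (Y * ksite A m j (RFF X F)) := by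
  have hs : ∀ Z : M2 N K, ksite A m j Z = (site m j Z).map (algebraMap K A) := fun Z => by
    rw [ksite, site_map]
  rw [qtrAll_eq_trace, qtrAll_eq_trace]
  change Matrix.trace ((qweight (Dmat Ψ) m).map (algebraMap K A) * _) =
    Matrix.trace ((qweight (Dmat Ψ) m).map (algebraMap K A) * _)
  rw [hs, hs, ← mul_assoc, ← Matrix.map_mul, qweight_mul_site h hF hFF hX, trace_map_mul_comm,
    trace_map_mul_comm, Matrix.map_mul, mul_assoc]

end WeightTwist

section Characteristic

variable {K : Type*} [Field K] {A : Type*} [Ring A] [Algebra K A] {N : ℕ}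
variable {R F Ψ : M2 N K} {M : Matrix (Fin N) (Fin N) A}

theorem IsClosedPair.qtr1_conj_castLE (h : IsClosedPair F Ψ) (hF : IsUnit F) (hFF : YB F)
    {n p : ℕ} (hp : p = n + 1) (X : Op N A (n + 1)) :
    qtr1 (Dmat Ψ) (ksite A (p + 1) n F *
        (embed (Fin.castLE (by omega)) X * ksite A (p + 1) n F⁻¹)) =
      embed (Fin.castLE (by omega)) (qtr1 (Dmat Ψ) X) := by
  subst hp
  exact h.qtr1_conj hF hFF X

theorem embed_kchain {m p l : ℕ} (h : p + l < m) (X : M2 N K) :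
    embed Fin.castSucc (kchain A m X p l) = kchain A (m + 1) X p l := by
  induction l with
  | zero => exact embed_one _
  | succ l ih =>
    change embed Fin.castSucc (kchain A m X p l * ksite A m (p + l) X) = _
    rw [embed_mul (Fin.castSucc_injective m), ih (by omega),
      embed_castSucc_site (i := p + l) (by omega)]
    rfl

theorem embed_scalar {k m : ℕ} {e : Fin k → Fin m} (he : Function.Injective e) (x : A) :
    embed e (Matrix.scalar (Fin k → Fin N) x) = Matrix.scalar _ x := by
  ext a b
  rw [← mul_one (embed e _), embed_mul_apply he]
  simp only [Matrix.scalar_apply, Matrix.diagonal_apply, ite_mul, zero_mul, Finset.sum_ite_eq,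
    Finset.mem_univ, if_true]
  have : Function.extend e (a ∘ e) a = a := by
    funext j
    by_cases hj : j ∈ Set.range e
    · obtain ⟨i, rfl⟩ := hj
      exact he.extend_apply _ _ i
    · exact Function.extend_apply' _ _ _ hj
  rw [this, Matrix.one_apply, mul_ite, mul_one, mul_zero]

theorem IsClosedPair.exists_qtrs_conj (h : IsClosedPair F Ψ) (hF : IsUnit F) (hFF : YB F)
    (k i : ℕ) : ∃ c : Op N A (k + 1 + i), kchain A (k + 1 + i) F k i * c = 1 ∧
      ∀ X : Op N A (k + i), qtrs (Dmat Ψ) (k + 1) i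
          (kchain A (k + 1 + i) F k i * (embed (Fin.castLE (by omega)) X * c)) =
        embed (Fin.castLE (Nat.le_succ k)) (qtrs (Dmat Ψ) k i X) := by
  induction i with
  | zero => exact ⟨1, one_mul 1, fun X => by rw [mul_one]; exact one_mul _⟩
  | succ i ih =>
    obtain ⟨c, hc, hX⟩ := ih
    have hchain : kchain A (k + 1 + i + 1) F k (i + 1) =
        embed Fin.castSucc (kchain A (k + 1 + i) F k i) * ksite A (k + 1 + i + 1) (k + i) F := by
      rw [embed_kchain (by omega)]
      rfl
    refine ⟨ksite A (k + 1 + i + 1) (k + i) F⁻¹ * embed Fin.castSucc c, ?_, fun X => ?_⟩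
    · change kchain A (k + 1 + i + 1) F k (i + 1) * _ = 1
      rw [hchain, mul_assoc, ← mul_assoc (ksite _ _ _ _), ksite_mul_inv _ _ hF, one_mul,
        ← embed_mul (Fin.castSucc_injective _), hc, embed_one]
    · change qtrs (Dmat Ψ) (k + 1) i (qtr1 (Dmat Ψ)
        (kchain A (k + 1 + i + 1) F k (i + 1) * _)) = embed _ (qtrs (Dmat Ψ) k i (qtr1 (Dmat Ψ) X))
      rw [← hX, hchain, mul_assoc, qtr1_embed_mul, ← mul_assoc (embed _ X),
        ← mul_assoc (ksite _ _ _ _),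
        qtr1_mul_embed, h.qtr1_conj_castLE hF hFF (by omega)]

theorem qtrs_zero_eq_scalar (D : Matrix (Fin N) (Fin N) K) (i : ℕ) (X : Op N A (0 + i)) :
    qtrs D 0 i X = Matrix.scalar _ (qtrAll D X) := by
  rw [qtrAll_qtrs]
  ext a b
  rw [Subsingleton.elim a default, Subsingleton.elim b default]
  simp [qtrAll]

theorem embed_castLE_kevalY_mul {k m q v i l : ℕ} (hkm : k ≤ m) (hq : q + v < k) (hi : i + l ≤ k)
    (Y : FreeAlgebra K (Fin v)) :
    embed (Fin.castLE hkm) (kevalY A k R q Y * kMbarSeg k F M i l) =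
      kevalY A m R q Y * kMbarSeg m F M i l := by
  have hY := embed_kevalY (A := A) (R := R) (e := Fin.castLE hkm)
    (fun _ => (Nat.zero_add _).symm) hq Y
  rw [zero_add] at hY
  rw [embed_mul (Fin.castLE_injective _), hY,
    embed_kMbarSeg (e := Fin.castLE hkm) (fun _ => rfl) hi]

theorem IsClosedPair.qtrs_kevalY_mul (h : IsClosedPair F Ψ) (hF : IsUnit F)
    (hc : Compatible R F) {v : ℕ} (Z : FreeAlgebra K (Fin v)) (k : ℕ) :
    qtrs (Dmat Ψ) k (v + 1) (kevalY A (k + (v + 1)) R k Z * kMbarSeg (k + (v + 1)) F M k (v + 1)) =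
      Matrix.scalar _
        (qtrAll (Dmat Ψ) (kevalY A (v + 1) R 0 Z * kMbarSeg (v + 1) F M 0 (v + 1))) := by
  induction k with
  | zero =>
    have : ∀ n, n = v + 1 → qtrAll (Dmat Ψ) (kevalY A n R 0 Z * kMbarSeg n F M 0 (v + 1)) =
        qtrAll (Dmat Ψ) (kevalY A (v + 1) R 0 Z * kMbarSeg (v + 1) F M 0 (v + 1)) := by
      rintro _ rfl; rfl
    rw [qtrs_zero_eq_scalar, this _ (Nat.zero_add _)]
  | succ k ih =>
    obtain ⟨c, hcc, hX⟩ := h.exists_qtrs_conj (A := A) hF hc.2.1 k (v + 1)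
    have hFF := Natural.of_yb hc.2.1
    have hs : SemiconjBy (kchain A (k + 1 + (v + 1)) F k (v + 1))
        (kevalY A (k + 1 + (v + 1)) R k Z * kMbarSeg (k + 1 + (v + 1)) F M k (v + 1))
        (kevalY A (k + 1 + (v + 1)) R (k + 1) Z *
          kMbarSeg (k + 1 + (v + 1)) F M (k + 1) (v + 1)) := by
      refine SemiconjBy.mul_right (semiconjBy_kevalY (fun t ht => ?_) Z)
        (semiconjBy_kchain_kMbarSeg hF hFF (by omega) le_rfl)
      have := semiconjBy_kchain (A := A) (m := k + 1 + (v + 1)) (p := k) (l := v + 1) (j := k + t)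
        hc.natural (by omega) (by omega) (by omega)
      rwa [add_right_comm k t 1] at this
    have := hX (kevalY A (k + (v + 1)) R k Z * kMbarSeg (k + (v + 1)) F M k (v + 1))
    rw [ih, embed_scalar (Fin.castLE_injective _),
      embed_castLE_kevalY_mul _ (by omega) le_rfl, ← mul_assoc, hs.eq, mul_assoc, hcc,
      mul_one] at this
    exact this

theorem IsClosedPair.qtrAll_mul_qtrAll (h : IsClosedPair F Ψ) (hF : IsUnit F)
    (hc : Compatible R F) {v w : ℕ} (Y : FreeAlgebra K (Fin v)) (Z : FreeAlgebra K (Fin w)) :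
    qtrAll (Dmat Ψ) (kevalY A (v + 1) R 0 Y * kMbarSeg (v + 1) F M 0 (v + 1)) *
        qtrAll (Dmat Ψ) (kevalY A (w + 1) R 0 Z * kMbarSeg (w + 1) F M 0 (w + 1)) =
      qtrAll (Dmat Ψ) (kevalY A (v + 1 + (w + 1)) R 0 Y * kevalY A (v + 1 + (w + 1)) R (v + 1) Z *
        kMbarSeg (v + 1 + (w + 1)) F M 0 (v + 1 + (w + 1))) := by
  have hcomm : Commute (kMbarSeg (v + 1 + (w + 1)) F M 0 (v + 1))
      (kevalY A (v + 1 + (w + 1)) R (v + 1) Z) :=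
    semiconjBy_kevalY (fun t _ => (commute_kMbarSeg_of_lt R (by omega)).symm) Z
  have hprod : kevalY A (v + 1 + (w + 1)) R 0 Y * kevalY A (v + 1 + (w + 1)) R (v + 1) Z *
      kMbarSeg (v + 1 + (w + 1)) F M 0 (v + 1 + (w + 1)) =
      embed (Fin.castLE (Nat.le_add_right (v + 1) (w + 1)))
          (kevalY A (v + 1) R 0 Y * kMbarSeg (v + 1) F M 0 (v + 1)) *
        (kevalY A (v + 1 + (w + 1)) R (v + 1) Z *
          kMbarSeg (v + 1 + (w + 1)) F M (v + 1) (w + 1)) := by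
    rw [embed_castLE_kevalY_mul _ (by omega) (by omega),
      kMbarSeg_add (m := v + 1 + (w + 1)) 0 (v + 1) (w + 1), zero_add]
    simp only [mul_assoc]
    rw [← mul_assoc (kMbarSeg _ _ _ _ _) (kevalY _ _ _ _ _), hcomm.eq, mul_assoc]
  rw [hprod, qtrAll_qtrs (m := v + 1) (j := w + 1), qtrs_embed_mul, h.qtrs_kevalY_mul hF hc,
    qtrAll_mul_scalar]

/-- `u` can be moved cyclically under the quantum trace against
`M_{\overline{1}}⋯M_{\overline{n}}`. -/
def IsTraceCentral (F Ψ : M2 N K) (M : Matrix (Fin N) (Fin N) A) (n : ℕ) (u : Op N A n) : Prop :=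
  ∀ X : Op N A n, qtrAll (Dmat Ψ) (u * X * kMbarSeg n F M 0 n) =
    qtrAll (Dmat Ψ) (X * u * kMbarSeg n F M 0 n)

theorem IsTraceCentral.one (n : ℕ) : IsTraceCentral F Ψ M n 1 := fun X => by
  rw [one_mul, mul_one]

theorem IsTraceCentral.mul {n : ℕ} {u u' : Op N A n} (hu : IsTraceCentral F Ψ M n u)
    (hu' : IsTraceCentral F Ψ M n u') : IsTraceCentral F Ψ M n (u * u') := fun X => by
  rw [mul_assoc u, hu, mul_assoc u', hu', mul_assoc X]

theorem isTraceCentral_ksite (h : IsClosedPair F Ψ) (hF : IsUnit F) (hc : Compatible R F)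
    (hM : IsGenerators R F M) (n j : ℕ) : IsTraceCentral F Ψ M n (ksite A n j R) := by
  intro X
  rcases Nat.lt_or_ge (j + 1) n with hj | hj
  · rw [mul_assoc, qtrAll_ksite_mul h hF hc.2.1 hc.natural, mul_assoc,
      (semiconjBy_kMbarSeg hF hc hM hj le_rfl).eq, mul_assoc X]
  · rw [ksite, site_of_le hj, one_mul, mul_one]

theorem isTraceCentral_kUstack (h : IsClosedPair F Ψ) (hF : IsUnit F) (hc : Compatible R F)
    (hM : IsGenerators R F M) (n k l : ℕ) : IsTraceCentral F Ψ M n (kUstack A n R k l) := by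
  have hchain : ∀ p l, IsTraceCentral F Ψ M n (kchain A n R p l) := fun p l => by
    induction l with
    | zero => exact IsTraceCentral.one n
    | succ l ih => exact ih.mul (isTraceCentral_ksite h hF hc hM n (p + l))
  induction l with
  | zero => exact IsTraceCentral.one n
  | succ l ih => exact (hchain l k).mul ih

theorem qtrAll_exchange (hR : IsUnit R) (hF : IsUnit F) (hc : Compatible R F)
    (h : IsClosedPair F Ψ) (hM : IsGenerators R F M) {v w n : ℕ}
    (hn : n = v + 1 + (w + 1)) (Y : FreeAlgebra K (Fin v)) (Z : FreeAlgebra K (Fin w)) :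
    qtrAll (Dmat Ψ) (kevalY A n R 0 Y * kevalY A n R (v + 1) Z * kMbarSeg n F M 0 n) =
      qtrAll (Dmat Ψ) (kevalY A n R 0 Z * kevalY A n R (w + 1) Y * kMbarSeg n F M 0 n) := by
  have hRR := Natural.of_yb hc.1
  have hY : SemiconjBy (kUstack A n R (v + 1) (w + 1)) (kevalY A n R 0 Y)
      (kevalY A n R (w + 1) Y) := semiconjBy_kevalY (fun t ht => by
    rw [zero_add]
    exact semiconjBy_kUstack_left hRR (by omega) (by omega)) Y
  have hZ : SemiconjBy (kUstack A n R (v + 1) (w + 1)) (kevalY A n R (v + 1) Z)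
      (kevalY A n R 0 Z) := semiconjBy_kevalY (fun t ht => by
    rw [zero_add]
    exact semiconjBy_kUstack_right hRR (by omega) (by omega)) Z
  have hsY : ∀ s < w, Commute (ksite A n (0 + s) R) (kevalY A n R (w + 1) Y) := fun s hs =>
    semiconjBy_kevalY (p := w + 1) (q := w + 1)
      (fun t ht => commute_site (Or.inl (by omega)) _ _) Y
  have hcomm : Commute (kevalY A n R (w + 1) Y) (kevalY A n R 0 Z) :=
    semiconjBy_kevalY (p := 0) (q := 0) (fun s hs => (hsY s hs).symm) Z
  have hU := hY.mul_right hZ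
  obtain ⟨u, hu⟩ := isUnit_kUstack (A := A) (m := n) hR (v + 1) (w + 1)
  have hT := isTraceCentral_kUstack h hF hc hM n (v + 1) (w + 1)
  rw [← hu] at hU hT
  rw [← hcomm.eq, ← mul_one (kevalY A n R (w + 1) Y * _), ← u.mul_inv, ← mul_assoc, ← hU.eq,
    mul_assoc _ _ (u⁻¹ : (Op N A n)ˣ).val, hT, mul_assoc _ _ u.val, u.inv_mul, mul_one]

theorem commute_qtrAll (hR : IsUnit R) (hF : IsUnit F) (hc : Compatible R F)
    (h : IsClosedPair F Ψ) (hM : IsGenerators R F M) {v w : ℕ}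
    (Y : FreeAlgebra K (Fin v)) (Z : FreeAlgebra K (Fin w)) :
    Commute (qtrAll (Dmat Ψ) (kevalY A (v + 1) R 0 Y * kMbarSeg (v + 1) F M 0 (v + 1)))
      (qtrAll (Dmat Ψ) (kevalY A (w + 1) R 0 Z * kMbarSeg (w + 1) F M 0 (w + 1))) := by
  rw [Commute, SemiconjBy, h.qtrAll_mul_qtrAll hF hc, h.qtrAll_mul_qtrAll hF hc,
    qtrAll_exchange hR hF hc h hM rfl, Nat.add_comm (v + 1)]

end Characteristic

/-- Proposition.  For a matrix of generators `M` of `M(R̂,F̂)`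
(with `R̂, F̂` compatible and `F̂` closed), any two elements
`α(Y^{(k)}) = Tr_F(1,…,k)(Y^{(k)} M_{\overline{1}}⋯M_{\overline{k}})` and
`β(Z^{(i)}) = Tr_F(1,…,i)(Z^{(i)} M_{\overline{1}}⋯M_{\overline{i}})` commute; in
particular the characteristic subalgebra — the subalgebra of `A` generated by
all such elements — is abelian.  (Here `k = k0+1`, `i = i0+1`.) -/
theorem characteristic_subalgebra_abelian {K : Type} [Field K] {A : Type} [Ring A]
    [Algebra K A] {N : ℕ} (R F Ψ : M2 N K) (hR : IsUnit R) (hF : IsUnit F)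
    (h : Compatible R F) (hΨ : IsClosedPair F Ψ)
    (M : Matrix (Fin N) (Fin N) A) (hM : IsGenerators R F M) :
    (∀ (k0 i0 : ℕ) (Y : FreeAlgebra K (Fin k0)) (Z : FreeAlgebra K (Fin i0)),
        qtrAll (Dmat Ψ)
            (evalY (R.map (algebraMap K A)) 0 Y *
              MbarSeg (k0 + 1) (F.map (algebraMap K A))
                ((F⁻¹).map (algebraMap K A)) M 0 (k0 + 1)) *
          qtrAll (Dmat Ψ)
            (evalY (R.map (algebraMap K A)) 0 Z *
              MbarSeg (i0 + 1) (F.map (algebraMap K A))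
                ((F⁻¹).map (algebraMap K A)) M 0 (i0 + 1)) =
        qtrAll (Dmat Ψ)
            (evalY (R.map (algebraMap K A)) 0 Z *
              MbarSeg (i0 + 1) (F.map (algebraMap K A))
                ((F⁻¹).map (algebraMap K A)) M 0 (i0 + 1)) *
          qtrAll (Dmat Ψ)
            (evalY (R.map (algebraMap K A)) 0 Y *
              MbarSeg (k0 + 1) (F.map (algebraMap K A))
                ((F⁻¹).map (algebraMap K A)) M 0 (k0 + 1))) ∧
    (∀ x ∈ Algebra.adjoin K (charSet R F Ψ M),
      ∀ y ∈ Algebra.adjoin K (charSet R F Ψ M), x * y = y * x) := by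
  refine ⟨fun k0 i0 Y Z => (commute_qtrAll hR hF h hΨ hM Y Z).eq, fun x hx y hy => ?_⟩
  refine (Algebra.commute_of_mem_adjoin_of_forall_mem_commute hy fun b hb => ?_).eq
  refine (Algebra.commute_of_mem_adjoin_of_forall_mem_commute hx fun a ha => ?_).symm
  obtain ⟨v, Y, rfl⟩ := ha
  obtain ⟨w, Z, rfl⟩ := hb
  exact commute_qtrAll hR hF h hΨ hM Z Y

end CHN
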